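/- arXiv:1102.2458 — 2 statements merged into one kernel-verified Lean document; each statement's English description precedes it below -/
import Mathlib

section
/- Let n ≥ 2, ν ∈ ℂ^n and y ∈ (ℝ_{>0})^n. Then W̃^n_ν(y) = 2^n ∫_{(ℝ_{>0})^{n−1}} ∏_{i=1}^n K_{2ν_n}( 2πy_i √((1+u_{i−1})(1+1/u_i)) ) · W̃^{n−1}_{ν̃}( y_2√(u_1/u_2), …, y_{n−1}√(u_{n−2}/u_{n−1}), y_n√(u_{n−1}) ) ∏_{i=1}^{n−1} du_i/u_i, with the conventions u_0 = 0 and 1/u_n = 0, both sides converging absolutely. -/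
noncomputable section

open MeasureTheory Finset

namespace SO

/-- Extend a `Fin n`-indexed real tuple to a `1`-based function on `ℕ` (default value `0`). -/
def extR (n : ℕ) (t : Fin n → ℝ) : ℕ → ℝ :=
  fun i => if h : 1 ≤ i ∧ i ≤ n then t ⟨i - 1, by omega⟩ else 0

/-- Extend a `Fin n`-indexed tuple of naturals to a `1`-based function on `ℕ` (default `0`). -/
def extN (n : ℕ) (t : Fin n → ℕ) : ℕ → ℕ :=
  fun i => if h : 1 ≤ i ∧ i ≤ n then t ⟨i - 1, by omega⟩ else 0

/-- The quadratic form `q_n(m, ν)`. -/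
def qB (n : ℕ) (m : ℕ → ℕ) (ν : ℕ → ℂ) : ℂ :=
  (∑ i ∈ Finset.Icc 1 (n - 1), ((m i : ℂ)) ^ 2) + (1 / 2) * (m n : ℂ) ^ 2
    - (∑ i ∈ Finset.Icc 1 (n - 1), (m i : ℂ) * (m (i + 1) : ℂ))
    + (∑ i ∈ Finset.Icc 1 (n - 1), (ν i - ν (i + 1)) * (m i : ℂ))
    + ν n * (m n : ℂ)

/-- Decrement the `i`-th coordinate by one. -/
def dec (m : ℕ → ℕ) (i : ℕ) : ℕ → ℕ := Function.update m i (m i - 1)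

/-- Auxiliary (fuel-indexed) recursion computing the coefficients `c_{n,m}(ν)`. -/
def cAux (n : ℕ) (ν : ℕ → ℂ) : ℕ → (ℕ → ℕ) → ℂ
  | 0, _ => 1
  | d + 1, m =>
      ((∑ i ∈ Finset.Icc 1 (n - 1), if m i = 0 then 0 else cAux n ν d (dec m i))
        + (1 / 2) * (if m n = 0 then 0 else cAux n ν d (dec m n))) / qB n m ν

/-- The coefficients `c_{n,m}(ν)`, determined by `c_{n,0} = 1` and the recurrence
`q_n(m,ν) c_{n,m}(ν) = ∑_{i=1}^{n-1} c_{n,m-e_i}(ν) + (1/2) c_{n,m-e_n}(ν)`. -/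
def cB (n : ℕ) (ν : ℕ → ℂ) (m : ℕ → ℕ) : ℂ :=
  cAux n ν (∑ i ∈ Finset.Icc 1 n, m i) m

/-- Pochhammer symbol `(a)_k = Γ(a+k)/Γ(a)` for `k ∈ ℤ`. -/
def poch (a : ℂ) (k : ℤ) : ℂ := Complex.Gamma (a + k) / Complex.Gamma a

/-- `z! ∈ ℂ` for `z ∈ ℤ`, with value `0` at negative integers (so that a factor `1/zfact z`
kills a summand containing the factorial of a negative integer). -/
def zfact (z : ℤ) : ℂ := if 0 ≤ z then (Nat.factorial z.toNat : ℂ) else 0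

/-- `Γ_n(ν) = ∏_{1≤i<j≤n} Γ(-ν_i-ν_j)Γ(-ν_i+ν_j) ∏_{i=1}^n Γ(-2ν_i)`. -/
def GammaN (n : ℕ) (ν : ℕ → ℂ) : ℂ :=
  (∏ i ∈ Finset.Icc 1 n, ∏ j ∈ Finset.Icc (i + 1) n,
      Complex.Gamma (-ν i - ν j) * Complex.Gamma (-ν i + ν j)) *
    ∏ i ∈ Finset.Icc 1 n, Complex.Gamma (-(2 * ν i))

/-- The Weyl group of type `B_n`: pairs of a permutation and a sign change. -/
abbrev SignedPerm (n : ℕ) := Equiv.Perm (Fin n) × (Fin n → Bool)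

/-- Action of a signed permutation on `ν ∈ ℂ^n` (1-based indexing). -/
def wAct (n : ℕ) (w : SignedPerm n) (ν : ℕ → ℂ) : ℕ → ℂ :=
  fun i =>
    if h : 1 ≤ i ∧ i ≤ n then
      (if w.2 ⟨i - 1, by omega⟩ then -1 else 1) * ν ((w.1 ⟨i - 1, by omega⟩ : Fin n).val + 1)
    else ν i

/-- Regularity of `ν ∈ ℂ^n`. -/
def Regular (n : ℕ) (ν : ℕ → ℂ) : Prop :=
  (∀ w : SignedPerm n, ∀ m : ℕ → ℕ,
      0 < ∑ i ∈ Finset.Icc 1 n, m i → qB n m (wAct n w ν) ≠ 0) ∧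
    ∀ w w' : SignedPerm n, w ≠ w' →
      ¬ ∀ i ∈ Finset.Icc 1 n, ∃ k : ℤ, wAct n w ν i - wAct n w' ν i = (k : ℂ)

/-- The fundamental Whittaker power series `M̃^n_ν(y)`. -/
def Mt (n : ℕ) (ν : ℕ → ℂ) (y : ℕ → ℝ) : ℂ :=
  ∑' m : Fin n → ℕ,
    cB n ν (extN n m) *
      ∏ i ∈ Finset.Icc 1 n,
        ((Real.pi * y i : ℝ) : ℂ) ^ (2 * ((extN n m i : ℂ) + ∑ j ∈ Finset.Icc 1 i, ν j))

/-- The modified Bessel function `K_s(z)` (for `Re z > 0`). -/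
def besselK (s z : ℂ) : ℂ :=
  (1 / 2) * ∫ t in Set.Ioi (0 : ℝ),
    Complex.exp (-(z / 2) * ((t : ℂ) + 1 / (t : ℂ))) * (t : ℂ) ^ s / (t : ℂ)

/-- The positive orthant in `(ℝ)^n`. -/
def posSet (n : ℕ) : Set (Fin n → ℝ) := {t | ∀ i, 0 < t i}

/-- The integrand in the recursive definition of `W̃^N_ν(y)`; `W` stands for `W̃^{N-1}_ν̃`. -/
def WtKernel (N : ℕ) (ν : ℕ → ℂ) (y : ℕ → ℝ) (W : (ℕ → ℝ) → ℂ)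
    (t : Fin N → ℝ) (u : Fin (N - 1) → ℝ) : ℂ :=
  ((∏ i ∈ Finset.Icc 1 N,
      Real.exp (-(Real.pi * y i) ^ 2 * extR N t i - 1 / extR N t i) : ℝ) : ℂ) *
    (∏ i ∈ Finset.Icc 1 N, ((Real.pi * y i : ℝ) : ℂ) ^ (2 * ν N)) *
    ((∏ i ∈ Finset.Icc 1 (N - 1),
        Real.exp (-(Real.pi * y i) ^ 2 * (extR N t i / extR N t (i + 1)) * extR (N - 1) u i
          - 1 / extR (N - 1) u i) : ℝ) : ℂ) *
    ((extR N t 1 : ℝ) : ℂ) ^ (2 * ν N) *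
    (∏ i ∈ Finset.Icc 1 (N - 1),
      ((extR N t (i + 1) * extR (N - 1) u i : ℝ) : ℂ) ^ (ν N)) *
    W (fun j => if j = N - 1 then y N * Real.sqrt (extR N t N / extR (N - 1) u (N - 1))
        else y (j + 1) * Real.sqrt (extR N t (j + 1) * extR (N - 1) u (j + 1) /
          (extR N t (j + 2) * extR (N - 1) u j))) *
    (((∏ i ∈ Finset.Icc 1 (N - 1), extR (N - 1) u i)⁻¹ : ℝ) : ℂ) *
    (((∏ i ∈ Finset.Icc 1 N, extR N t i)⁻¹ : ℝ) : ℂ)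

/-- The class one Whittaker function `W̃^n_ν(y)`, defined recursively. -/
def Wt : ℕ → (ℕ → ℂ) → (ℕ → ℝ) → ℂ
  | 0, _, _ => 0
  | 1, ν, y => 2 * besselK (2 * ν 1) (2 * Real.pi * y 1)
  | n + 2, ν, y =>
      ∫ t in posSet (n + 2), ∫ u in posSet (n + 1),
        WtKernel (n + 2) ν y (fun z => Wt (n + 1) ν z) t u

/-- The auxiliary function `V_ν(x)`. -/
def Vnu (n : ℕ) (ν : ℕ → ℂ) (x : ℕ → ℝ) : ℂ :=
  ∫ u in posSet (n - 1),
    ((∏ i ∈ Finset.Icc 1 (n - 1),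
        Real.exp (-(Real.pi * x i) ^ 2 * extR (n - 1) u i - 1 / extR (n - 1) u i) : ℝ) : ℂ) *
      (∏ i ∈ Finset.Icc 1 n, ((Real.pi * x i : ℝ) : ℂ) ^ (2 * ν n)) *
      (∏ i ∈ Finset.Icc 1 (n - 1), ((extR (n - 1) u i : ℝ) : ℂ) ^ (ν n)) *
      Wt (n - 1) ν (fun j => if j = n - 1 then x n * Real.sqrt (1 / extR (n - 1) u (n - 1))
          else x (j + 1) * Real.sqrt (extR (n - 1) u (j + 1) / extR (n - 1) u j)) *
      (((∏ i ∈ Finset.Icc 1 (n - 1), extR (n - 1) u i)⁻¹ : ℝ) : ℂ)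

/-- The coefficients `b_l(ν)` (zero unless all `l_i ≥ 0` and `l_{n-1} ≥ l_n`). -/
def bB (n : ℕ) (ν : ℕ → ℂ) (l : ℕ → ℤ) : ℂ :=
  if (∀ i ∈ Finset.Icc 1 n, 0 ≤ l i) ∧ l n ≤ l (n - 1) then
    (-1 : ℂ) ^ (l n) *
      ∑' k : Fin (n - 2) → ℕ,
        cB (n - 1) ν (fun i => if i = n - 1 then (l n).toNat else extN (n - 2) k i) /
          ((∏ i ∈ Finset.Icc 1 (n - 2), zfact (l i - (extN (n - 2) k i : ℤ))) *
            zfact (l (n - 1) - l n) *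
            ∏ i ∈ Finset.Icc 1 (n - 1),
              poch (ν i - ν n + 1) (l i - (extN (n - 2) k (i - 1) : ℤ)))
  else 0

/-- The coefficients `b^P_l(ν)` (zero unless all `l_i ≥ 0` and `l_{n-1} ≥ l_n`). -/
def bP (n : ℕ) (P : Finset ℕ) (ν : ℕ → ℂ) (l : ℕ → ℤ) : ℂ :=
  if (∀ i ∈ Finset.Icc 1 n, 0 ≤ l i) ∧ l n ≤ l (n - 1) then
    (-1 : ℂ) ^ (l n) *
      ∑' k : Fin (n - 2) → ℕ,
        cB (n - 1) ν (fun i => if i = n - 1 then (l n).toNat else extN (n - 2) k i) /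
          ((∏ i ∈ (Finset.Icc 1 (n - 2)).filter (· ∈ P),
              zfact (l i - (extN (n - 2) k i : ℤ)) *
                poch (ν i - ν n + 1) (l i - (extN (n - 2) k (i - 1) : ℤ))) *
            (∏ i ∈ (Finset.Icc 1 (n - 2)).filter (· ∉ P),
              zfact (l i - (extN (n - 2) k (i - 1) : ℤ)) *
                poch (-ν i + ν n + 1) (l i - (extN (n - 2) k i : ℤ))) *
            (if n - 1 ∈ P then
                zfact (l (n - 1) - l n) *
                  poch (ν (n - 1) - ν n + 1) (l (n - 1) - (extN (n - 2) k (n - 2) : ℤ))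
              else
                zfact (l (n - 1) - (extN (n - 2) k (n - 2) : ℤ)) *
                  poch (-ν (n - 1) + ν n + 1) (l (n - 1) - l n)))
  else 0

/-- `ν^{(p)} = (ν_1, …, ν_{p-1}, ν_n, ν_p, …, ν_{n-1})`. -/
def nuP (n p : ℕ) (ν : ℕ → ℂ) : ℕ → ℂ :=
  fun i => if i < p then ν i else if i = p then ν n else ν (i - 1)

/-- `ν̄^{(q)} = (ν_1, …, ν_{q-1}, -ν_n, ν_q, …, ν_{n-1})`. -/
def nuBar (n q : ℕ) (ν : ℕ → ℂ) : ℕ → ℂ :=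
  fun i => if i < q then ν i else if i = q then -ν n else ν (i - 1)

/-- `Γ^P(ν)`. -/
def GammaP (n : ℕ) (P : Finset ℕ) (ν : ℕ → ℂ) : ℂ :=
  GammaN (n - 1) ν *
    (∏ i ∈ (Finset.Icc 1 (n - 1)).filter (· ∈ P), Complex.Gamma (-ν i + ν n)) *
    ∏ i ∈ (Finset.Icc 1 (n - 1)).filter (· ∉ P), Complex.Gamma (ν i - ν n)

/-- `Γ^p(ν) = Γ^P(ν)` with `P = {1, …, p-1}`. -/
def Gammap (n p : ℕ) (ν : ℕ → ℂ) : ℂ := GammaP n (Finset.Icc 1 (p - 1)) ν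

/-- `b^p_l(ν) = b^P_l(ν)` with `P = {1, …, p-1}`. -/
def bp (n p : ℕ) (ν : ℕ → ℂ) (l : ℕ → ℤ) : ℂ := bP n (Finset.Icc 1 (p - 1)) ν l

/-- `Γ^{p,Q}(ν)`. -/
def GammaPQ (n p : ℕ) (Q : Finset ℕ) (ν : ℕ → ℂ) : ℂ :=
  Gammap n p ν *
    (∏ i ∈ (Finset.Icc 1 n).filter (· ∈ Q), Complex.Gamma (-(nuP n p ν i) - ν n)) *
    ∏ i ∈ (Finset.Icc 1 n).filter (· ∉ Q), Complex.Gamma (nuP n p ν i + ν n)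

/-- The coefficients `c^{p,Q}_m(ν)` (zero if some `m_i < 0`). -/
def cPQ (n p : ℕ) (Q : Finset ℕ) (ν : ℕ → ℂ) (m : ℕ → ℤ) : ℂ :=
  if ∀ i ∈ Finset.Icc 1 n, 0 ≤ m i then
    ∑' l : Fin n → ℕ,
      (-1 : ℂ) ^ ((extN n l n : ℤ)) * bp n p ν (fun i => (extN n l i : ℤ)) /
        ((∏ i ∈ (Finset.Icc 1 n).filter (· ∈ Q),
            zfact (m i - (extN n l i : ℤ)) *
              poch (nuP n p ν i + ν n + 1) (m i - (extN n l (i - 1) : ℤ))) *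
          ∏ i ∈ (Finset.Icc 1 n).filter (· ∉ Q),
            zfact (m i - (extN n l (i - 1) : ℤ)) *
              poch (-(nuP n p ν i) - ν n + 1) (m i - (extN n l i : ℤ)))
  else 0

/-- The power series `M̃^{p,Q}_ν(y)`. -/
def MPQ (n p : ℕ) (Q : Finset ℕ) (ν : ℕ → ℂ) (y : ℕ → ℝ) : ℂ :=
  ∑' m : Fin n → ℕ,
    cPQ n p Q ν (fun i => (extN n m i : ℤ)) *
      (∏ i ∈ (Finset.Icc 1 n).filter (· ∈ Q),
        ((Real.pi * y i : ℝ) : ℂ) ^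
          (2 * ((extN n m i : ℂ) + ∑ j ∈ Finset.Icc 1 i, nuP n p ν j))) *
      ∏ i ∈ (Finset.Icc 1 n).filter (· ∉ Q),
        ((Real.pi * y i : ℝ) : ℂ) ^
          (2 * ((extN n m i : ℂ) + ∑ j ∈ Finset.Icc 1 (i - 1), nuP n p ν j - ν n))

/-- The Mellin-transform integrand. -/
def Tintegrand (n : ℕ) (ν : ℕ → ℂ) (s : ℕ → ℂ) (y : Fin n → ℝ) : ℂ :=
  Wt n ν (extR n y) *
    (∏ i ∈ Finset.Icc 1 n, ((Real.pi * extR n y i : ℝ) : ℂ) ^ (2 * s i)) *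
    (((∏ i ∈ Finset.Icc 1 n, extR n y i)⁻¹ : ℝ) : ℂ)

/-- The multiple Mellin transform `T^n_ν(s)` of the class one Whittaker function. -/
def Tn (n : ℕ) (ν : ℕ → ℂ) (s : ℕ → ℂ) : ℂ := ∫ y in posSet n, Tintegrand n ν s y


/-- The integrand of the recursive integral representation of Theorem `intrep2`. -/
def rhs3 (n : ℕ) (ν : ℕ → ℂ) (y : ℕ → ℝ) (u : Fin (n - 1) → ℝ) : ℂ :=
  (∏ i ∈ Finset.Icc 1 n,
      besselK (2 * ν n)
        ((2 * Real.pi * y i *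
          Real.sqrt ((1 + extR (n - 1) u (i - 1)) * (1 + (extR (n - 1) u i)⁻¹)) : ℝ) : ℂ)) *
    Wt (n - 1) ν (fun j => if j = n - 1 then y n * Real.sqrt (extR (n - 1) u (n - 1))
        else y (j + 1) * Real.sqrt (extR (n - 1) u j / extR (n - 1) u (j + 1))) *
    (((∏ i ∈ Finset.Icc 1 (n - 1), extR (n - 1) u i)⁻¹ : ℝ) : ℂ)

theorem prodIcc {M : Type*} [CommMonoid M] (n : ℕ) (f : ℕ → M) :
    ∏ i ∈ Finset.Icc 1 n, f i = ∏ i : Fin n, f (i + 1) := by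
  induction n with
  | zero => simp
  | succ n ih => rw [Finset.prod_Icc_succ_top (by omega), ih, Fin.prod_univ_castSucc]; simp

theorem extR_fin {n : ℕ} (t : Fin n → ℝ) (i : Fin n) : extR n t (i + 1) = t i := by
  have := i.2
  simp [extR]

theorem extR_zero {n : ℕ} (t : Fin n → ℝ) : extR n t 0 = 0 := by simp [extR]

theorem extR_gt {n : ℕ} (t : Fin n → ℝ) {i : ℕ} (h : n < i) : extR n t i = 0 := by
  simp [extR]; intros; omega

theorem measurable_extR {n : ℕ} (i : ℕ) : Measurable (fun t : Fin n → ℝ => extR n t i) := by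
  unfold extR
  split_ifs <;> fun_prop

/-- multiplicative measure restricted to orthant as a product measure -/
theorem posSet_eq (n : ℕ) : posSet n = Set.pi Set.univ (fun _ : Fin n => Set.Ioi (0 : ℝ)) := by
  ext t; simp [posSet]

theorem measurableSet_posSet (n : ℕ) : MeasurableSet (posSet n) := by
  rw [posSet_eq]
  exact MeasurableSet.univ_pi fun _ => measurableSet_Ioi

theorem restrict_posSet (n : ℕ) : (volume : Measure (Fin n → ℝ)).restrict (posSet n) =
    Measure.pi (fun _ : Fin n => (volume : Measure ℝ).restrict (Set.Ioi 0)) := by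
  rw [posSet_eq, volume_pi, Measure.restrict_pi_pi]

/-- the inversion map -/
def invMap {m : ℕ} (c v : Fin m → ℝ) : Fin m → ℝ := fun j => c j / v j

theorem invMap_image {m : ℕ} (c : Fin m → ℝ) (hc : c ∈ posSet m) :
    Set.image (invMap c) (posSet m) = posSet m := by
  ext u
  constructor
  · rintro ⟨v, hv, rfl⟩ j
    exact div_pos (hc j) (hv j)
  · intro hu
    refine ⟨invMap c u, fun j => div_pos (hc j) (hu j), ?_⟩
    ext j
    have := (hc j).ne'
    have := (hu j).ne'
    simp [invMap]
    field_simp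

theorem invMap_inj {m : ℕ} (c : Fin m → ℝ) (hc : c ∈ posSet m) :
    Set.InjOn (invMap c) (posSet m) := by
  intro u hu v hv h
  ext j
  have h1 := congrFun h j
  have := (hc j).ne'
  have := (hu j).ne'
  have := (hv j).ne'
  simp only [invMap] at h1
  field_simp at h1
  exact h1.symm

/-- derivative of inversion map -/
def invDer {m : ℕ} (c v : Fin m → ℝ) : (Fin m → ℝ) →L[ℝ] (Fin m → ℝ) :=
  ContinuousLinearMap.pi (fun j =>
    (ContinuousLinearMap.toSpanSingleton ℝ (-(c j / v j ^ 2))).comp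
      (ContinuousLinearMap.proj j))

theorem invMap_der {m : ℕ} (c : Fin m → ℝ) (v : Fin m → ℝ) (hv : v ∈ posSet m) :
    HasFDerivWithinAt (invMap c) (invDer c v) (posSet m) v := by
  apply HasFDerivAt.hasFDerivWithinAt
  unfold invDer
  rw [hasFDerivAt_pi]
  intro j
  have h1 : HasDerivAt (fun x : ℝ => c j / x) (-(c j / v j ^ 2)) (v j) := by
    have := (hasDerivAt_inv (hv j).ne').const_mul (c j)
    simpa [div_eq_mul_inv] using this
  have h2 : HasFDerivAt (fun x : Fin m → ℝ => x j) (ContinuousLinearMap.proj (R := ℝ) (φ := fun _ : Fin m => ℝ) j) v :=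
    (ContinuousLinearMap.proj (R := ℝ) (φ := fun _ : Fin m => ℝ) j).hasFDerivAt
  exact HasFDerivAt.comp v h1.hasFDerivAt h2

theorem invDer_det {m : ℕ} (c : Fin m → ℝ) (hc : c ∈ posSet m) (v : Fin m → ℝ) :
    |(invDer c v).det| = ∏ j, c j / v j ^ 2 := by
  unfold invDer
  rw [ContinuousLinearMap.det_pi, Finset.abs_prod]
  refine Finset.prod_congr rfl fun j _ => ?_
  have : 0 ≤ c j / v j ^ 2 := div_nonneg (hc j).le (sq_nonneg _)
  simp [abs_div, abs_of_pos (hc j)]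

theorem cov_integrable {m : ℕ} (c : Fin m → ℝ) (hc : c ∈ posSet m) (f : (Fin m → ℝ) → ℂ) :
    IntegrableOn f (posSet m) ↔
      IntegrableOn (fun v => (∏ j, c j / v j ^ 2) • f (invMap c v)) (posSet m) := by
  have := integrableOn_image_iff_integrableOn_abs_det_fderiv_smul volume (measurableSet_posSet m)
    (fun v hv => invMap_der c v hv) (invMap_inj c hc) f
  rw [invMap_image c hc] at this
  rw [this]
  simp_rw [invDer_det c hc]

theorem cov_integral {m : ℕ} {E : Type*} [NormedAddCommGroup E] [NormedSpace ℝ E]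
    (c : Fin m → ℝ) (hc : c ∈ posSet m) (f : (Fin m → ℝ) → E) :
    ∫ u in posSet m, f u =
      ∫ v in posSet m, (∏ j, c j / v j ^ 2) • f (invMap c v) := by
  have := integral_image_eq_integral_abs_det_fderiv_smul volume (measurableSet_posSet m)
    (fun v hv => invMap_der c v hv) (invMap_inj c hc) f
  rw [invMap_image c hc] at this
  rw [this]
  simp_rw [invDer_det c hc]

/-- `min (t^k) (t^{-k})` -/
def mm (k : ℕ) (t : ℝ) : ℝ := ((max t t⁻¹) ^ k)⁻¹

theorem mm_nonneg (k : ℕ) {t : ℝ} (ht : 0 < t) : 0 ≤ mm k t := by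
  unfold mm; positivity

theorem measurable_mm (k : ℕ) : Measurable (mm k) := by
  unfold mm; fun_prop

theorem mm_integrable (k : ℕ) (c : ℝ) (hc : |c| < k) :
    IntegrableOn (fun t => mm k t * t ^ c / t) (Set.Ioi 0) := by
  obtain ⟨h1, h2⟩ := abs_lt.1 hc
  rw [← Set.Ioc_union_Ioi_eq_Ioi (zero_le_one' ℝ)]
  refine IntegrableOn.union ?_ ?_
  · have : IntegrableOn (fun t : ℝ => t ^ ((k : ℝ) + c - 1)) (Set.Ioc 0 1) := by
      rw [← intervalIntegrable_iff_integrableOn_Ioc_of_le zero_le_one]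
      exact intervalIntegral.intervalIntegrable_rpow' (by linarith)
    refine this.congr_fun (fun t ht => ?_) measurableSet_Ioc
    have h3 : t ≤ t⁻¹ := ht.2.trans ((one_le_inv₀ ht.1).2 ht.2)
    simp only [mm, max_eq_right h3]
    rw [Real.rpow_sub_one ht.1.ne', Real.rpow_add ht.1, Real.rpow_natCast]
    simp
  · have : IntegrableOn (fun t : ℝ => t ^ (-(k : ℝ) + c - 1)) (Set.Ioi 1) :=
      integrableOn_Ioi_rpow_of_lt (by linarith) one_pos
    refine this.congr_fun (fun t ht => ?_) measurableSet_Ioi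
    have ht' : 1 < t := ht
    have h0 : 0 < t := by linarith
    have h3 : t⁻¹ ≤ t := (inv_le_one_of_one_le₀ ht'.le).trans ht'.le
    simp only [mm, max_eq_left h3]
    rw [Real.rpow_sub_one h0.ne', Real.rpow_add h0, Real.rpow_neg h0.le, Real.rpow_natCast]

def gC (s : ℂ) (a b t : ℝ) : ℂ := (Real.exp (-a * t - b / t) : ℂ) * (t : ℂ) ^ s / (t : ℂ)

def gR (s a b t : ℝ) : ℝ := Real.exp (-a * t - b / t) * t ^ s / t

theorem norm_gC (s : ℂ) (a b : ℝ) {t : ℝ} (ht : 0 < t) : ‖gC s a b t‖ = gR s.re a b t := by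
  simp only [gC, gR, norm_div, norm_mul, Complex.norm_real, Complex.norm_cpow_eq_rpow_re_of_pos ht,
    Real.norm_eq_abs, abs_of_pos ht, Real.abs_exp]

theorem gC_ofReal (s a b : ℝ) {t : ℝ} (ht : 0 < t) : gC s a b t = (gR s a b t : ℂ) := by
  simp only [gC, gR]
  push_cast
  rw [Complex.ofReal_cpow ht.le]

theorem exp_bound (k : ℕ) {z t : ℝ} (hz : 0 < z) (ht : 0 < t) :
    Real.exp (-z * t - z / t) ≤ k.factorial * (z ^ k)⁻¹ * mm k t := by
  have hx : 0 < z * max t t⁻¹ := by positivity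
  have h1 : z * max t t⁻¹ ≤ z * t + z / t := by
    rcases max_cases t t⁻¹ with ⟨h, _⟩ | ⟨h, _⟩ <;> rw [h]
    · have : 0 < z / t := by positivity
      linarith
    · have : 0 < z * t := by positivity
      rw [div_eq_mul_inv]; linarith
  have h2 := Real.pow_div_factorial_le_exp _ hx.le k
  have h3 : Real.exp (-z * t - z / t) ≤ Real.exp (-(z * max t t⁻¹)) :=
    Real.exp_le_exp.2 (by linarith)
  refine h3.trans ?_
  rw [Real.exp_neg]
  have h4 : 0 < (z * max t t⁻¹) ^ k / k.factorial := by positivity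
  refine (inv_anti₀ h4 h2).trans (le_of_eq ?_)
  unfold mm
  rw [mul_pow, inv_div, div_eq_mul_inv, mul_inv, mul_assoc]

theorem measurable_gR (s a b : ℝ) : Measurable (gR s a b) := by
  unfold gR; fun_prop

theorem measurable_gC (s : ℂ) (a b : ℝ) : Measurable (gC s a b) := by
  unfold gC; fun_prop

theorem gR_nonneg (s a b : ℝ) {t : ℝ} (ht : 0 < t) : 0 ≤ gR s a b t := by
  unfold gR; positivity

theorem gR_le (k : ℕ) (s : ℝ) {z t : ℝ} (hz : 0 < z) (ht : 0 < t) :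
    gR s z z t ≤ k.factorial * (z ^ k)⁻¹ * (mm k t * t ^ s / t) := by
  unfold gR
  have := exp_bound k hz ht
  calc _ ≤ (k.factorial * (z ^ k)⁻¹ * mm k t) * t ^ s / t := by gcongr
    _ = _ := by ring

theorem gR_zz_integrable (s : ℝ) {z : ℝ} (hz : 0 < z) :
    IntegrableOn (gR s z z) (Set.Ioi 0) := by
  obtain ⟨k, hk⟩ := exists_nat_gt |s|
  refine Integrable.mono' ((mm_integrable k s hk).const_mul (k.factorial * (z ^ k)⁻¹))
    (measurable_gR _ _ _).aestronglyMeasurable ?_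
  filter_upwards [ae_restrict_mem measurableSet_Ioi] with t ht
  rw [Real.norm_of_nonneg (gR_nonneg _ _ _ ht)]
  exact gR_le k s hz ht

theorem gR_integrable (s : ℝ) {a b : ℝ} (ha : 0 < a) (hb : 0 < b) :
    IntegrableOn (gR s a b) (Set.Ioi 0) := by
  have hz : 0 < min a b := lt_min ha hb
  refine Integrable.mono' (gR_zz_integrable s hz) (measurable_gR _ _ _).aestronglyMeasurable ?_
  filter_upwards [ae_restrict_mem measurableSet_Ioi] with t ht
  have ht' : 0 < t := ht
  rw [Real.norm_of_nonneg (gR_nonneg _ _ _ ht)]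
  unfold gR
  gcongr
  · nlinarith [min_le_left a b]
  · exact min_le_right a b

theorem gC_integrable (s : ℂ) {a b : ℝ} (ha : 0 < a) (hb : 0 < b) :
    IntegrableOn (gC s a b) (Set.Ioi 0) := by
  refine Integrable.mono' (gR_integrable s.re ha hb) (measurable_gC _ _ _).aestronglyMeasurable ?_
  filter_upwards [ae_restrict_mem measurableSet_Ioi] with t ht
  rw [norm_gC _ _ _ ht]

theorem gR_zz_int_le (k : ℕ) (s : ℝ) (hk : |s| < k) : ∃ C : ℝ, 0 ≤ C ∧ ∀ z : ℝ, 0 < z →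
    ∫ t in Set.Ioi 0, gR s z z t ≤ C * (z ^ k)⁻¹ := by
  refine ⟨k.factorial * ∫ t in Set.Ioi 0, mm k t * t ^ s / t, ?_, fun z hz => ?_⟩
  · refine mul_nonneg (by positivity) (setIntegral_nonneg measurableSet_Ioi fun t ht => ?_)
    have ht' : 0 < t := ht
    have := mm_nonneg k ht'
    positivity
  · calc _ ≤ ∫ t in Set.Ioi 0, k.factorial * (z ^ k)⁻¹ * (mm k t * t ^ s / t) := by
          refine setIntegral_mono_on (gR_zz_integrable s hz)
            ((mm_integrable k s hk).const_mul _) measurableSet_Ioi fun t ht => gR_le k s hz ht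
      _ = _ := by rw [integral_const_mul]; ring

theorem gC_scale (s : ℂ) {a b : ℝ} (ha : 0 < a) (hb : 0 < b) :
    ∫ t in Set.Ioi 0, gC s a b t =
      ((b / a : ℝ) : ℂ) ^ (s / 2) * ∫ t in Set.Ioi 0, gC s (√(a * b)) (√(a * b)) t := by
  set c := √(b / a) with hcdef
  have hc : 0 < c := by positivity
  have hca : a * c = √(a * b) := by
    rw [hcdef, show √(a*b) = √(a^2 * (b / a)) by congr 1; field_simp,
      Real.sqrt_mul (by positivity), Real.sqrt_sq ha.le]
  have hcb : b / c = √(a * b) := by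
    rw [← hca, div_eq_iff hc.ne', mul_assoc, ← sq, hcdef, Real.sq_sqrt (by positivity)]
    field_simp
  have h := integral_comp_mul_left_Ioi (gC s a b) 0 hc
  rw [mul_zero] at h
  have h2 : ∫ t in Set.Ioi 0, gC s a b t = (c : ℂ) * ∫ t in Set.Ioi 0, gC s a b (c * t) := by
    rw [h, Complex.real_smul, ← mul_assoc]
    push_cast
    rw [mul_inv_cancel₀ (by exact_mod_cast hc.ne'), one_mul]
  rw [h2, ← integral_const_mul, ← integral_const_mul]
  refine setIntegral_congr_fun measurableSet_Ioi fun t ht => ?_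
  have ht' : 0 < t := ht
  simp only [gC]
  rw [show -a * (c * t) - b / (c * t) = -√(a*b) * t - √(a*b) / t by
    rw [← hcb]; nth_rewrite 1 [hcb]; rw [← hca]; field_simp]
  have h5 : ((b / a : ℝ) : ℂ) ^ (s / 2) = (c : ℂ) ^ s := by
    have : b / a = c ^ 2 := by rw [hcdef, Real.sq_sqrt (by positivity)]
    rw [this]
    push_cast
    rw [sq, ← Complex.ofReal_mul, Complex.ofReal_mul, Complex.mul_cpow_ofReal_nonneg hc.le hc.le,
      ← Complex.cpow_add _ _ (by exact_mod_cast hc.ne')]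
    congr 1; ring
  rw [h5, Complex.ofReal_mul, Complex.mul_cpow_ofReal_nonneg hc.le ht'.le]
  have : (c : ℂ) ≠ 0 := by exact_mod_cast hc.ne'
  have : (t : ℂ) ≠ 0 := by exact_mod_cast ht'.ne'
  field_simp

theorem gC_bessel (s : ℂ) (z : ℝ) :
    ∫ t in Set.Ioi 0, gC s z z t = 2 * besselK s ((2 * z : ℝ) : ℂ) := by
  unfold besselK
  rw [← mul_assoc]
  norm_num
  refine setIntegral_congr_fun measurableSet_Ioi fun t ht => ?_
  simp only [gC]
  push_cast
  congr 3
  ring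

theorem gR_scale (s : ℝ) {a b : ℝ} (ha : 0 < a) (hb : 0 < b) :
    ∫ t in Set.Ioi 0, gR s a b t =
      (b / a) ^ (s / 2) * ∫ t in Set.Ioi 0, gR s (√(a * b)) (√(a * b)) t := by
  have h := gC_scale s ha hb
  have e : ∀ a b : ℝ, ∫ t in Set.Ioi 0, gC s a b t = ((∫ t in Set.Ioi 0, gR s a b t : ℝ) : ℂ) := by
    intro a b
    rw [← integral_complex_ofReal]
    exact setIntegral_congr_fun measurableSet_Ioi fun t ht => gC_ofReal s a b ht
  rw [e, e, show (s : ℂ) / 2 = ((s / 2 : ℝ) : ℂ) by push_cast; rfl,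
    ← Complex.ofReal_cpow (by positivity)] at h
  exact_mod_cast h

theorem gR_int_le (l : ℕ) (s : ℝ) (hl : |s| < 2 * l) : ∃ C : ℝ, 0 ≤ C ∧ ∀ a b : ℝ, 0 < a → 0 < b →
    ∫ t in Set.Ioi 0, gR s a b t ≤ C * ((b / a) ^ (s / 2) * ((a * b) ^ l)⁻¹) := by
  obtain ⟨C, hC, h⟩ := gR_zz_int_le (2 * l) s (by push_cast; exact hl)
  refine ⟨C, hC, fun a b ha hb => ?_⟩
  rw [gR_scale s ha hb]
  have := h (√(a * b)) (by positivity)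
  rw [pow_mul, Real.sq_sqrt (by positivity)] at this
  calc _ ≤ (b / a) ^ (s / 2) * (C * ((a * b) ^ l)⁻¹) := by gcongr
    _ = _ := by ring

/-- kernel with normalized index type -/
def KW (m : ℕ) (ν : ℕ → ℂ) (y : ℕ → ℝ) (W : (ℕ → ℝ) → ℂ)
    (t : Fin (m + 1) → ℝ) (u : Fin m → ℝ) : ℂ := WtKernel (m + 1) ν y W t u

theorem KW_def (m : ℕ) (ν : ℕ → ℂ) (y : ℕ → ℝ) (W : (ℕ → ℝ) → ℂ)
    (t : Fin (m + 1) → ℝ) (u : Fin m → ℝ) : KW m ν y W t u =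
  ((∏ i ∈ Finset.Icc 1 (m + 1),
      Real.exp (-(Real.pi * y i) ^ 2 * extR (m + 1) t i - 1 / extR (m + 1) t i) : ℝ) : ℂ) *
    (∏ i ∈ Finset.Icc 1 (m + 1), ((Real.pi * y i : ℝ) : ℂ) ^ (2 * ν (m + 1))) *
    ((∏ i ∈ Finset.Icc 1 m,
        Real.exp (-(Real.pi * y i) ^ 2 * (extR (m + 1) t i / extR (m + 1) t (i + 1)) * extR m u i
          - 1 / extR m u i) : ℝ) : ℂ) *
    ((extR (m + 1) t 1 : ℝ) : ℂ) ^ (2 * ν (m + 1)) *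
    (∏ i ∈ Finset.Icc 1 m,
      ((extR (m + 1) t (i + 1) * extR m u i : ℝ) : ℂ) ^ (ν (m + 1))) *
    W (fun j => if j = m then y (m + 1) * Real.sqrt (extR (m + 1) t (m + 1) / extR m u m)
        else y (j + 1) * Real.sqrt (extR (m + 1) t (j + 1) * extR m u (j + 1) /
          (extR (m + 1) t (j + 2) * extR m u j))) *
    (((∏ i ∈ Finset.Icc 1 m, extR m u i)⁻¹ : ℝ) : ℂ) *
    (((∏ i ∈ Finset.Icc 1 (m + 1), extR (m + 1) t i)⁻¹ : ℝ) : ℂ) := rfl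

theorem measurable_KW (m : ℕ) (ν : ℕ → ℂ) (W : (ℕ → ℝ) → ℂ) (hW : Measurable W) :
    Measurable (fun p : ((ℕ → ℝ) × (Fin (m + 1) → ℝ)) × (Fin m → ℝ) =>
      KW m ν p.1.1 W p.1.2 p.2) := by
  have ht : ∀ i, Measurable (fun p : ((ℕ → ℝ) × (Fin (m + 1) → ℝ)) × (Fin m → ℝ) =>
      extR (m + 1) p.1.2 i) := fun i => (measurable_extR i).comp (by fun_prop)
  have hu : ∀ i, Measurable (fun p : ((ℕ → ℝ) × (Fin (m + 1) → ℝ)) × (Fin m → ℝ) =>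
      extR m p.2 i) := fun i => (measurable_extR i).comp (by fun_prop)
  have hA : Measurable (fun (p : ((ℕ → ℝ) × (Fin (m + 1) → ℝ)) × (Fin m → ℝ)) (j : ℕ) =>
      if j = m then p.1.1 (m + 1) * Real.sqrt (extR (m + 1) p.1.2 (m + 1) / extR m p.2 m)
        else p.1.1 (j + 1) * Real.sqrt (extR (m + 1) p.1.2 (j + 1) * extR m p.2 (j + 1) /
          (extR (m + 1) p.1.2 (j + 2) * extR m p.2 j))) := by
    refine measurable_pi_lambda _ fun j => ?_
    split_ifs <;> fun_prop
  have hWA := hW.comp hA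
  simp only [Function.comp_def] at hWA
  simp only [KW_def]
  refine ((Measurable.mul ?_ hWA).mul ?_).mul ?_ <;> fun_prop

theorem measurable_int_kernel (m : ℕ) (ν : ℕ → ℂ) (W : (ℕ → ℝ) → ℂ) (hW : Measurable W) :
    Measurable (fun y => ∫ t in posSet (m + 1), ∫ u in posSet m, KW m ν y W t u) := by
  apply StronglyMeasurable.measurable
  apply StronglyMeasurable.integral_prod_right
  apply StronglyMeasurable.integral_prod_right (f := fun (p : (ℕ → ℝ) × (Fin (m + 1) → ℝ)) u =>
    KW m ν p.1 W p.2 u)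
  exact (measurable_KW m ν W hW).stronglyMeasurable

theorem Wt_succ (n : ℕ) (ν : ℕ → ℂ) (y : ℕ → ℝ) : Wt (n + 1 + 1) ν y =
    ∫ t in posSet (n + 1 + 1), ∫ u in posSet (n + 1), KW (n + 1) ν y (Wt (n + 1) ν) t u := by
  simp only [Wt, KW]

theorem measurable_Wt (n : ℕ) (ν : ℕ → ℂ) : Measurable (Wt n ν) := by
  induction n with
  | zero => simp only [Wt]; fun_prop
  | succ n ih =>
    cases n with
    | zero =>
      simp only [Wt, besselK]
      have : StronglyMeasurable (fun y : ℕ → ℝ => ∫ t in Set.Ioi (0 : ℝ),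
          Complex.exp (-((2 * Real.pi * y 1 : ℂ) / 2) * ((t : ℂ) + 1 / (t : ℂ))) *
            (t : ℂ) ^ (2 * ν 1) / (t : ℂ)) := by
        apply StronglyMeasurable.integral_prod_right
        apply Measurable.stronglyMeasurable
        unfold Function.uncurry
        fun_prop
      have := this.measurable
      fun_prop
    | succ n =>
      rw [funext (Wt_succ n ν)]
      exact measurable_int_kernel (n + 1) ν _ ih

/-- arguments of the lower-rank function -/
def argW (m : ℕ) (y : ℕ → ℝ) (v : Fin m → ℝ) : ℕ → ℝ := fun j =>
  if j = m then y (m + 1) * Real.sqrt (extR m v m)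
        else y (j + 1) * Real.sqrt (extR m v j / extR m v (j + 1))

def aF (m : ℕ) (y : ℕ → ℝ) (v : Fin m → ℝ) (i : Fin (m + 1)) : ℝ :=
  (Real.pi * y (i + 1)) ^ 2 * (1 + (extR m v (i + 1))⁻¹)

def bF (m : ℕ) (v : Fin m → ℝ) (i : Fin (m + 1)) : ℝ := 1 + extR m v i

def GF (m : ℕ) (s : ℂ) (y : ℕ → ℝ) (W : (ℕ → ℝ) → ℂ) (v : Fin m → ℝ) : ℂ :=
  (∏ i : Fin (m + 1), ((Real.pi * y (i + 1) : ℝ) : ℂ) ^ (2 * s)) *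
    (∏ j, (v j : ℂ) ^ (-s)) * W (argW m y v) * ((∏ j, (v j)⁻¹ : ℝ) : ℂ)

def FF (m : ℕ) (s : ℂ) (y : ℕ → ℝ) (W : (ℕ → ℝ) → ℂ) (t : Fin (m + 1) → ℝ) (v : Fin m → ℝ) : ℂ :=
  (∏ i, gC (2 * s) (aF m y v i) (bF m v i) (t i)) * GF m s y W v

theorem extR_nonneg {m : ℕ} {v : Fin m → ℝ} (hv : v ∈ posSet m) (i : ℕ) : 0 ≤ extR m v i := by
  unfold extR
  split_ifs
  · exact (hv _).le
  · exact le_rfl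

theorem bF_pos {m : ℕ} {v : Fin m → ℝ} (hv : v ∈ posSet m) (i : Fin (m + 1)) : 0 < bF m v i := by
  have := extR_nonneg hv i
  unfold bF; linarith

theorem aF_pos {m : ℕ} {y : ℕ → ℝ} (hy : ∀ i ∈ Finset.Icc 1 (m + 1), 0 < y i)
    {v : Fin m → ℝ} (hv : v ∈ posSet m) (i : Fin (m + 1)) : 0 < aF m y v i := by
  have := extR_nonneg hv (i + 1)
  have := hy (i + 1) (by simp; omega)
  have := Real.pi_pos
  unfold aF; positivity

theorem prod_b {m : ℕ} (v : Fin m → ℝ) : ∏ i, bF m v i = ∏ j, (1 + v j) := by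
  rw [Fin.prod_univ_succ]
  simp [bF, extR_zero, extR_fin]

theorem prod_a {m : ℕ} (y : ℕ → ℝ) (v : Fin m → ℝ) : ∏ i, aF m y v i =
    (∏ i : Fin (m + 1), (Real.pi * y (i + 1)) ^ 2) * ∏ j, (1 + (v j)⁻¹) := by
  simp only [aF]
  rw [Finset.prod_mul_distrib]
  congr 1
  rw [Fin.prod_univ_castSucc]
  simp [extR_fin, extR_gt]

theorem prod_ab_ratio {m : ℕ} {y : ℕ → ℝ} (hy : ∀ i ∈ Finset.Icc 1 (m + 1), 0 < y i)
    {v : Fin m → ℝ} (hv : v ∈ posSet m) :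
    (∏ i, bF m v i / aF m y v i) * (∏ i : Fin (m + 1), (Real.pi * y (i + 1)) ^ 2) = ∏ j, v j := by
  rw [Finset.prod_div_distrib, prod_b, prod_a]
  have h1 : (∏ i : Fin (m + 1), (Real.pi * y (i + 1)) ^ 2) ≠ 0 := by
    refine Finset.prod_ne_zero_iff.2 fun i _ => ?_
    have := hy (i + 1) (by simp; omega)
    have := Real.pi_pos
    positivity
  have h2 : (∏ j, (1 + (v j)⁻¹)) ≠ 0 := by
    refine Finset.prod_ne_zero_iff.2 fun i _ => ?_
    have := hv i
    positivity
  rw [div_mul_eq_mul_div, mul_comm, mul_div_mul_left _ _ h1, div_eq_iff h2,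
    ← Finset.prod_mul_distrib]
  refine Finset.prod_congr rfl fun j _ => ?_
  have := (hv j).ne'
  field_simp
  ring

theorem prod_ofReal_cpow {ι : Type*} (S : Finset ι) (f : ι → ℝ) (hf : ∀ i ∈ S, 0 ≤ f i) (s : ℂ) :
    ∏ i ∈ S, (f i : ℂ) ^ s = ((∏ i ∈ S, f i : ℝ) : ℂ) ^ s := by
  classical
  induction S using Finset.induction_on with
  | empty => simp
  | insert a S ha ih =>
    rw [Finset.prod_insert ha, Finset.prod_insert ha, ih fun i hi => hf i (by simp [hi]),
      Complex.ofReal_mul, Complex.mul_cpow_ofReal_nonneg (hf a (by simp))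
      (Finset.prod_nonneg fun i hi => hf i (by simp [hi]))]

theorem sq_cpow {x : ℝ} (hx : 0 < x) (s : ℂ) : (x : ℂ) ^ (2 * s) = ((x ^ 2 : ℝ) : ℂ) ^ s := by
  rw [sq, Complex.ofReal_mul, Complex.mul_cpow_ofReal_nonneg hx.le hx.le,
    ← Complex.cpow_add _ _ (by exact_mod_cast hx.ne')]
  congr 1; ring

theorem ratio_cpow {m : ℕ} {y : ℕ → ℝ} (hy : ∀ i ∈ Finset.Icc 1 (m + 1), 0 < y i)
    {v : Fin m → ℝ} (hv : v ∈ posSet m) (s : ℂ) :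
    (∏ i, ((bF m v i / aF m y v i : ℝ) : ℂ) ^ s) *
      (∏ i : Fin (m + 1), ((Real.pi * y (i + 1) : ℝ) : ℂ) ^ (2 * s)) *
      (∏ j, (v j : ℂ) ^ (-s)) = 1 := by
  have hy' : ∀ i : Fin (m + 1), 0 < Real.pi * y (i + 1) := fun i =>
    mul_pos Real.pi_pos (hy (i + 1) (by simp; omega))
  have h1 : ∏ i : Fin (m + 1), ((Real.pi * y (i + 1) : ℝ) : ℂ) ^ (2 * s) =
      ((∏ i : Fin (m + 1), (Real.pi * y (i + 1)) ^ 2 : ℝ) : ℂ) ^ s := by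
    rw [← prod_ofReal_cpow _ _ (fun i _ => by positivity)]
    exact Finset.prod_congr rfl fun i _ => sq_cpow (hy' i) s
  have hr : ∀ i, 0 ≤ bF m v i / aF m y v i := fun i => (div_pos (bF_pos hv i) (aF_pos hy hv i)).le
  rw [h1, prod_ofReal_cpow _ _ (fun i _ => hr i), prod_ofReal_cpow _ _ (fun j _ => (hv j).le),
    ← Complex.mul_cpow_ofReal_nonneg (Finset.prod_nonneg fun i _ => hr i)
      (Finset.prod_nonneg fun i _ => by positivity), ← Complex.ofReal_mul,
    prod_ab_ratio hy hv, ← Complex.cpow_add _ _ ?_]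
  · simp
  · exact_mod_cast (Finset.prod_pos fun j _ => hv j).ne'

theorem sqrt_ab {m : ℕ} {y : ℕ → ℝ} (hy : ∀ i ∈ Finset.Icc 1 (m + 1), 0 < y i)
    (v : Fin m → ℝ) (i : Fin (m + 1)) : √(aF m y v i * bF m v i) =
      Real.pi * y (i + 1) * √((1 + extR m v i) * (1 + (extR m v (i + 1))⁻¹)) := by
  have : 0 < Real.pi * y (i + 1) := mul_pos Real.pi_pos (hy (i + 1) (by simp; omega))
  rw [aF, bF, mul_assoc, Real.sqrt_mul (by positivity), Real.sqrt_sq this.le]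
  congr 2; ring

def rhsW (m : ℕ) (s : ℂ) (y : ℕ → ℝ) (W : (ℕ → ℝ) → ℂ) (v : Fin m → ℝ) : ℂ :=
  (∏ i : Fin (m + 1), besselK (2 * s)
        ((2 * Real.pi * y (i + 1) *
          Real.sqrt ((1 + extR m v i) * (1 + (extR m v (i + 1))⁻¹)) : ℝ) : ℂ)) *
    W (argW m y v) * ((∏ j, (v j)⁻¹ : ℝ) : ℂ)

theorem rhs3_eq (m : ℕ) (ν : ℕ → ℂ) (y : ℕ → ℝ) :
    rhs3 (m + 1) ν y = rhsW m (ν (m + 1)) y (Wt m ν) := by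
  funext v
  simp only [rhs3, rhsW, prodIcc, Nat.add_sub_cancel]
  congr 2
  simp only [extR_fin, Finset.prod_inv_distrib]

theorem FF_int {m : ℕ} (s : ℂ) {y : ℕ → ℝ} (hy : ∀ i ∈ Finset.Icc 1 (m + 1), 0 < y i)
    (W : (ℕ → ℝ) → ℂ) {v : Fin m → ℝ} (hv : v ∈ posSet m) :
    ∫ t in posSet (m + 1), FF m s y W t v = 2 ^ (m + 1) * rhsW m s y W v := by
  simp only [FF]
  rw [integral_mul_const, restrict_posSet,
    integral_fintype_prod_eq_prod (fun i => gC (2 * s) (aF m y v i) (bF m v i))]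
  have : ∀ i, ∫ t in Set.Ioi 0, gC (2 * s) (aF m y v i) (bF m v i) t =
      2 * (((bF m v i / aF m y v i : ℝ) : ℂ) ^ s * besselK (2 * s) ((2 * Real.pi * y (i + 1) *
          Real.sqrt ((1 + extR m v i) * (1 + (extR m v (i + 1))⁻¹)) : ℝ) : ℂ)) := by
    intro i
    rw [gC_scale _ (aF_pos hy hv i) (bF_pos hv i), gC_bessel, sqrt_ab hy]
    rw [show 2 * s / 2 = s by ring, ← mul_assoc (2 : ℝ), ← mul_assoc (2 : ℝ)]
    ring
  simp_rw [this]
  rw [Finset.prod_mul_distrib, Finset.prod_mul_distrib, Finset.prod_const, Finset.card_univ,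
    Fintype.card_fin, GF, rhsW]
  have h := ratio_cpow hy hv s
  linear_combination (2 ^ (m + 1) * (∏ i : Fin (m + 1), besselK (2 * s)
        ((2 * Real.pi * y (i + 1) *
          Real.sqrt ((1 + extR m v i) * (1 + (extR m v (i + 1))⁻¹)) : ℝ) : ℂ)) *
    W (argW m y v) * ((∏ j, (v j)⁻¹ : ℝ) : ℂ)) * h

theorem arg_eq {m : ℕ} (y : ℕ → ℝ) {t : Fin (m + 1) → ℝ} (ht : t ∈ posSet (m + 1))
    {v : Fin m → ℝ} (hv : v ∈ posSet m) (hm : 1 ≤ m) :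
    (fun j => if j = m then y (m + 1) * √(extR (m + 1) t (m + 1) /
        extR m (invMap (fun j => t j.succ) v) m)
        else y (j + 1) * √(extR (m + 1) t (j + 1) * extR m (invMap (fun j => t j.succ) v) (j + 1) /
          (extR (m + 1) t (j + 2) * extR m (invMap (fun j => t j.succ) v) j))) = argW m y v := by
  have key : ∀ k : Fin m, extR (m + 1) t (k + 2) / extR m (invMap (fun j => t j.succ) v) (k + 1)
      = v k := by
    intro k
    have h1 : extR (m + 1) t (k + 2) = t k.succ := extR_fin t k.succ
    rw [h1, extR_fin, invMap]
    have := (ht k.succ).ne'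
    have := (hv k).ne'
    field_simp
  funext j
  unfold argW
  split_ifs with h
  · congr 2
    have := key ⟨m - 1, by omega⟩
    have e := extR_fin v ⟨m - 1, by omega⟩
    simp only [show m - 1 + 2 = m + 1 by omega, show m - 1 + 1 = m by omega] at this e
    rw [this, e]
  · congr 2
    rcases Nat.eq_zero_or_pos j with rfl | hj
    · simp [extR_zero]
    rcases lt_or_ge m j with hj2 | hj2
    · rw [extR_gt t (by omega), extR_gt v hj2]; simp
    have k1 := key ⟨j - 1, by omega⟩
    have k2 := key ⟨j, by omega⟩
    have e1 := extR_fin v ⟨j - 1, by omega⟩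
    have e2 := extR_fin v ⟨j, by omega⟩
    simp only [show j - 1 + 2 = j + 1 by omega, show j - 1 + 1 = j by omega] at k1 k2 e1 e2
    rw [e1, e2, ← k1, ← k2, div_div_div_eq]
    congr 1; ring

theorem kernel_eq {m : ℕ} (hm : 1 ≤ m) (ν : ℕ → ℂ) (y : ℕ → ℝ) (W : (ℕ → ℝ) → ℂ)
    {t : Fin (m + 1) → ℝ} (ht : t ∈ posSet (m + 1)) {v : Fin m → ℝ} (hv : v ∈ posSet m) :
    (∏ j, t (Fin.succ j) / v j ^ 2) • KW m ν y W t (invMap (fun j => t j.succ) v) =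
      FF m (ν (m + 1)) y W t v := by
  have hA := arg_eq y ht hv hm
  unfold FF GF
  rw [KW_def, hA]
  simp only [prodIcc]
  set s := ν (m + 1)
  have e1 : ∀ i : Fin (m + 1), extR (m + 1) t (i + 1) = t i := extR_fin t
  have e2 : ∀ i : Fin m, extR (m + 1) t (i + 1 + 1) = t i.succ := fun i => extR_fin t i.succ
  have e3 : ∀ i : Fin m, extR (m + 1) t (i + 1) = t i.castSucc := fun i => extR_fin t i.castSucc
  have e0 : extR (m + 1) t 1 = t 0 := extR_fin t 0
  simp only [e0, e1, e2, e3, extR_fin]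
  -- exponentials
  have hexp : (∏ i : Fin (m + 1), Real.exp (-(Real.pi * y (i + 1)) ^ 2 * t i - 1 / t i)) *
      (∏ j : Fin m, Real.exp (-(Real.pi * y (j + 1)) ^ 2 * (t j.castSucc / t j.succ) *
        invMap (fun j => t j.succ) v j - 1 / invMap (fun j => t j.succ) v j)) =
      ∏ i, Real.exp (-aF m y v i * t i - bF m v i / t i) := by
    have h1 : ∀ i : Fin (m + 1), Real.exp (-aF m y v i * t i - bF m v i / t i) =
        Real.exp (-(Real.pi * y (i + 1)) ^ 2 * t i - 1 / t i) *
        (Real.exp (-(Real.pi * y (i + 1)) ^ 2 * t i * (extR m v (i + 1))⁻¹) *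
          Real.exp (- extR m v i / t i)) := by
      intro i
      rw [← Real.exp_add, ← Real.exp_add]
      congr 1
      unfold aF bF
      ring
    simp_rw [h1]
    rw [Finset.prod_mul_distrib, Finset.prod_mul_distrib]
    congr 1
    rw [Fin.prod_univ_castSucc (fun i : Fin (m + 1) =>
      Real.exp (-(Real.pi * y (i + 1)) ^ 2 * t i * (extR m v (i + 1))⁻¹)),
      Fin.prod_univ_succ (fun i : Fin (m + 1) => Real.exp (- extR m v i / t i))]
    simp only [Fin.val_castSucc, Fin.val_last, Fin.val_zero, Fin.val_succ, extR_fin, extR_zero,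
      extR_gt v (Nat.lt_succ_self m)]
    simp only [inv_zero, mul_zero, neg_zero, zero_div, Real.exp_zero, mul_one, one_mul]
    rw [← Finset.prod_mul_distrib]
    refine Finset.prod_congr rfl fun j _ => ?_
    rw [← Real.exp_add]
    congr 1
    have := (ht j.succ).ne'
    have := (hv j).ne'
    simp only [invMap]
    field_simp
    ring
  have hpow : (t 0 : ℂ) ^ (2 * s) * ∏ j : Fin m,
      ((t j.succ * invMap (fun j => t j.succ) v j : ℝ) : ℂ) ^ s =
      (∏ i, (t i : ℂ) ^ (2 * s)) * ∏ j, (v j : ℂ) ^ (-s) := by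
    rw [Fin.prod_univ_succ, mul_assoc, ← Finset.prod_mul_distrib]
    congr 1
    refine Finset.prod_congr rfl fun j _ => ?_
    have h1 := ht j.succ
    have h2 := hv j
    rw [sq_cpow h1, Complex.cpow_neg, ← Complex.inv_cpow, ← Complex.ofReal_inv,
      ← Complex.mul_cpow_ofReal_nonneg (by positivity) (by positivity), ← Complex.ofReal_mul]
    · congr 2
      simp only [invMap]
      field_simp
    · rw [Complex.arg_ofReal_of_nonneg h2.le]; exact Real.pi_pos.ne
  have hjac : (∏ j, t (Fin.succ j) / v j ^ 2) * (∏ j, invMap (fun j => t j.succ) v j)⁻¹ =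
      ∏ j, (v j)⁻¹ := by
    rw [← Finset.prod_inv_distrib, ← Finset.prod_mul_distrib]
    refine Finset.prod_congr rfl fun j _ => ?_
    have := (ht j.succ).ne'
    have := (hv j).ne'
    simp only [invMap]
    field_simp
  have hg : ∏ i, gC (2 * s) (aF m y v i) (bF m v i) (t i) =
      ((∏ i, Real.exp (-aF m y v i * t i - bF m v i / t i) : ℝ) : ℂ) *
        (∏ i, (t i : ℂ) ^ (2 * s)) * (((∏ i, t i)⁻¹ : ℝ) : ℂ) := by
    simp only [gC, div_eq_mul_inv _ ((_ : ℝ) : ℂ)]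
    rw [Finset.prod_mul_distrib, Finset.prod_mul_distrib]
    push_cast
    rw [Finset.prod_inv_distrib]
  rw [hg, ← hexp, ← hjac, Complex.real_smul]
  push_cast at hpow ⊢
  linear_combination ((∏ j, (t (Fin.succ j) : ℂ) / v j ^ 2) *
    (∏ j, (invMap (fun j => t j.succ) v j : ℂ))⁻¹ * (∏ i, (t i : ℂ))⁻¹ * W (argW m y v) *
    (∏ i : Fin (m + 1), ((Real.pi : ℂ) * y (i + 1)) ^ (2 * s)) *
    (∏ i : Fin (m + 1), Complex.exp (-(Real.pi * y (i + 1)) ^ 2 * t i - 1 / t i)) *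
      (∏ j : Fin m, Complex.exp (-(Real.pi * y (j + 1)) ^ 2 * (t j.castSucc / t j.succ) *
        invMap (fun j => t j.succ) v j - 1 / invMap (fun j => t j.succ) v j))) * hpow

theorem measurable_argW (m : ℕ) (y : ℕ → ℝ) : Measurable (argW m y) := by
  have hu : ∀ i, Measurable (fun v : Fin m → ℝ => extR m v i) := measurable_extR
  refine measurable_pi_lambda _ fun j => ?_
  unfold argW
  split_ifs <;> fun_prop

theorem measurable_GF (m : ℕ) (s : ℂ) (y : ℕ → ℝ) (W : (ℕ → ℝ) → ℂ) (hW : Measurable W) :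
    Measurable (GF m s y W) := by
  have hWA := hW.comp (measurable_argW m y)
  simp only [Function.comp_def] at hWA
  unfold GF
  refine (Measurable.mul ?_ hWA).mul ?_ <;> fun_prop

theorem measurable_FF (m : ℕ) (s : ℂ) (y : ℕ → ℝ) (W : (ℕ → ℝ) → ℂ) (hW : Measurable W) :
    Measurable (fun z : (Fin (m + 1) → ℝ) × (Fin m → ℝ) => FF m s y W z.1 z.2) := by
  have hu : ∀ i, Measurable (fun z : (Fin (m + 1) → ℝ) × (Fin m → ℝ) => extR m z.2 i) :=
    fun i => (measurable_extR i).comp (by fun_prop)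
  have hG := (measurable_GF m s y W hW).comp
    (measurable_snd : Measurable (Prod.snd : (Fin (m + 1) → ℝ) × (Fin m → ℝ) → (Fin m → ℝ)))
  simp only [Function.comp_def] at hG
  unfold FF gC aF bF
  fun_prop

theorem FF_integrable_t {m : ℕ} (s : ℂ) {y : ℕ → ℝ} (hy : ∀ i ∈ Finset.Icc 1 (m + 1), 0 < y i)
    (W : (ℕ → ℝ) → ℂ) {v : Fin m → ℝ} (hv : v ∈ posSet m) :
    IntegrableOn (fun t => FF m s y W t v) (posSet (m + 1)) := by
  unfold IntegrableOn
  simp only [FF]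
  rw [restrict_posSet]
  exact (Integrable.fintype_prod (f := fun i => gC (2 * s) (aF m y v i) (bF m v i))
    fun i => gC_integrable (2 * s) (aF_pos hy hv i) (bF_pos hv i)).mul_const _

theorem FF_norm_int {m : ℕ} (s : ℂ) (y : ℕ → ℝ)
    (W : (ℕ → ℝ) → ℂ) (v : Fin m → ℝ) :
    ∫ t in posSet (m + 1), ‖FF m s y W t v‖ =
      (∏ i, ∫ t in Set.Ioi 0, gR (2 * s.re) (aF m y v i) (bF m v i) t) * ‖GF m s y W v‖ := by
  have : ∀ t ∈ posSet (m + 1), ‖FF m s y W t v‖ =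
      (∏ i, gR (2 * s.re) (aF m y v i) (bF m v i) (t i)) * ‖GF m s y W v‖ := by
    intro t ht
    simp only [FF, norm_mul, norm_prod]
    congr 1
    refine Finset.prod_congr rfl fun i _ => ?_
    rw [norm_gC _ _ _ (ht i)]
    simp
  rw [setIntegral_congr_fun (measurableSet_posSet _) this, integral_mul_const, restrict_posSet,
    integral_fintype_prod_eq_prod (fun i => gR (2 * s.re) (aF m y v i) (bF m v i))]

theorem FF_norm_le {m : ℕ} (s : ℂ) {y : ℕ → ℝ} (hy : ∀ i ∈ Finset.Icc 1 (m + 1), 0 < y i)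
    (W : (ℕ → ℝ) → ℂ) {v : Fin m → ℝ} (hv : v ∈ posSet m) (l : ℕ) (C : ℝ)
    (hC : ∀ a b : ℝ, 0 < a → 0 < b → ∫ t in Set.Ioi 0, gR (2 * s.re) a b t ≤
      C * ((b / a) ^ (2 * s.re / 2) * ((a * b) ^ l)⁻¹)) (hC0 : 0 ≤ C) :
    ∫ t in posSet (m + 1), ‖FF m s y W t v‖ ≤
      C ^ (m + 1) * ((∏ i : Fin (m + 1), (Real.pi * y (i + 1)) ^ 2) ^ l)⁻¹ *
        ((∏ j, mm l (v j)) * ‖W (argW m y v)‖ * ∏ j, (v j)⁻¹) := by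
  rw [FF_norm_int]
  have hpos : ∀ i : Fin (m + 1), 0 < Real.pi * y (i + 1) := fun i =>
    mul_pos Real.pi_pos (hy (i + 1) (by simp; omega))
  have h1 : ∏ i, ∫ t in Set.Ioi 0, gR (2 * s.re) (aF m y v i) (bF m v i) t ≤
      ∏ i, C * ((bF m v i / aF m y v i) ^ s.re * ((aF m y v i * bF m v i) ^ l)⁻¹) := by
    refine Finset.prod_le_prod (fun i _ => ?_) (fun i _ => ?_)
    · exact setIntegral_nonneg measurableSet_Ioi fun t ht => gR_nonneg _ _ _ ht
    · have := hC _ _ (aF_pos hy hv i) (bF_pos hv i)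
      rwa [mul_div_cancel_left₀ _ (two_ne_zero' ℝ)] at this
  rw [Finset.prod_mul_distrib, Finset.prod_mul_distrib, Finset.prod_const, Finset.card_univ,
    Fintype.card_fin, Finset.prod_inv_distrib, Finset.prod_pow, Finset.prod_mul_distrib,
    prod_a, prod_b] at h1
  have h2 : (((∏ i : Fin (m + 1), (Real.pi * y (i + 1)) ^ 2) * (∏ j, (1 + (v j)⁻¹)) *
      ∏ j, (1 + v j)) ^ l)⁻¹ ≤
      ((∏ i : Fin (m + 1), (Real.pi * y (i + 1)) ^ 2) ^ l)⁻¹ * ∏ j, mm l (v j) := by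
    rw [mul_assoc, mul_pow, mul_inv, ← Finset.prod_mul_distrib,
      ← Finset.prod_pow _ l (fun j => (1 + (v j)⁻¹) * (1 + v j)), ← Finset.prod_inv_distrib]
    refine mul_le_mul_of_nonneg_left (Finset.prod_le_prod (fun j _ => ?_) fun j _ => ?_) ?_
    · have := hv j; positivity
    · have := hv j
      unfold mm
      have h3 : max (v j) (v j)⁻¹ ≤ (1 + (v j)⁻¹) * (1 + v j) := by
        have h4 : 0 < (v j)⁻¹ := by positivity
        have h5 : (v j)⁻¹ * v j = 1 := inv_mul_cancel₀ this.ne'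
        apply max_le <;> nlinarith
      gcongr
    · have : 0 < ∏ i : Fin (m + 1), (Real.pi * y (i + 1)) ^ 2 :=
        Finset.prod_pos fun i _ => pow_pos (hpos i) 2
      positivity
  have h6 := congrArg norm (ratio_cpow hy hv s)
  rw [norm_mul, norm_mul, norm_prod, norm_one] at h6
  have h7 : ∀ i, ‖((bF m v i / aF m y v i : ℝ) : ℂ) ^ s‖ = (bF m v i / aF m y v i) ^ s.re :=
    fun i => Complex.norm_cpow_eq_rpow_re_of_pos (div_pos (bF_pos hv i) (aF_pos hy hv i)) _
  simp only [h7] at h6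
  have h8 : ‖((∏ j, (v j)⁻¹ : ℝ) : ℂ)‖ = ∏ j, (v j)⁻¹ := by
    rw [Complex.norm_real, Real.norm_of_nonneg]
    exact Finset.prod_nonneg fun j _ => inv_nonneg.2 (hv j).le
  have hr0 : 0 ≤ ∏ i, (bF m v i / aF m y v i) ^ s.re := Finset.prod_nonneg fun i _ =>
    Real.rpow_nonneg (div_pos (bF_pos hv i) (aF_pos hy hv i)).le _
  have h9 : ∏ i, ∫ t in Set.Ioi 0, gR (2 * s.re) (aF m y v i) (bF m v i) t ≤
      C ^ (m + 1) * ((∏ i, (bF m v i / aF m y v i) ^ s.re) *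
      (((∏ i : Fin (m + 1), (Real.pi * y (i + 1)) ^ 2) ^ l)⁻¹ * ∏ j, mm l (v j))) := by
    refine h1.trans ?_
    gcongr
  refine (mul_le_mul_of_nonneg_right h9 (norm_nonneg _)).trans (le_of_eq ?_)
  rw [GF, norm_mul, norm_mul, norm_mul, h8]
  linear_combination (C ^ (m + 1) * ((∏ i : Fin (m + 1), (Real.pi * y (i + 1)) ^ 2) ^ l)⁻¹ *
        ((∏ j, mm l (v j)) * ‖W (argW m y v)‖ * ∏ j, (v j)⁻¹)) * h6

/-- polynomial bound -/
def HB (m : ℕ) (W : (ℕ → ℝ) → ℂ) : Prop :=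
  ∃ C : ℝ, 0 ≤ C ∧ ∃ a : ℕ → ℝ, ∀ y : ℕ → ℝ, (∀ i ∈ Finset.Icc 1 m, 0 < y i) →
    ‖W y‖ ≤ C * ∏ i : Fin m, y (i + 1) ^ a i

/-- shift of exponents -/
def sh (a : ℕ → ℝ) : ℕ → ℝ
  | 0 => 0
  | k + 1 => a k

/-- `v` extended by one -/
def wF (m : ℕ) (v : Fin m → ℝ) (k : ℕ) : ℝ := if h : k < m then v ⟨k, h⟩ else 1

theorem wF_pos {m : ℕ} {v : Fin m → ℝ} (hv : v ∈ posSet m) (k : ℕ) : 0 < wF m v k := by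
  unfold wF; split_ifs
  · exact hv _
  · exact one_pos

theorem argW_eq {m : ℕ} (y : ℕ → ℝ) (v : Fin m → ℝ) (i : Fin m) :
    argW m y v (i + 1) = y (i + 2) * √(wF m v i / wF m v (i + 1)) := by
  have hi := i.2
  have e1 : wF m v i = v i := by simp [wF]
  unfold argW
  split_ifs with h
  · have e2 : wF m v (i + 1) = 1 := by simp [wF, h]
    rw [e1, e2, div_one]
    have := extR_fin v i
    rw [h] at this
    rw [this, show (i : ℕ) + 2 = m + 1 by omega]
  · have hi' : (i : ℕ) + 1 < m := by omega
    have e2 : wF m v (i + 1) = v ⟨i + 1, hi'⟩ := by simp [wF, hi']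
    have e3 := extR_fin v ⟨i + 1, hi'⟩
    simp only at e3
    rw [e1, e2, extR_fin, e3]

theorem argW_prod {m : ℕ} (a : ℕ → ℝ) {y : ℕ → ℝ} (hy : ∀ i ∈ Finset.Icc 1 (m + 1), 0 < y i)
    {v : Fin m → ℝ} (hv : v ∈ posSet m) :
    ∏ i : Fin m, argW m y v (i + 1) ^ a i =
      (∏ i : Fin m, y (i + 2) ^ a i) * ∏ j : Fin m, v j ^ ((a j - sh a j) / 2) := by
  have hw := wF_pos hv
  have h1 : ∀ i : Fin m, argW m y v (i + 1) ^ a i =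
      y (i + 2) ^ a i * (wF m v i ^ (a i / 2) * wF m v (i + 1) ^ (-(a i / 2))) := by
    intro i
    rw [argW_eq, Real.mul_rpow (hy (i + 2) (Finset.mem_Icc.2 ⟨by omega, by omega⟩)).le (Real.sqrt_nonneg _),
      Real.sqrt_eq_rpow, ← Real.rpow_mul (div_pos (hw _) (hw _)).le,
      show (1 / 2 : ℝ) * a i = a i / 2 by ring,
      Real.div_rpow (hw _).le (hw _).le, Real.rpow_neg (hw _).le, div_eq_mul_inv]
  simp_rw [h1]
  rw [Finset.prod_mul_distrib, Finset.prod_mul_distrib]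
  congr 1
  have h2 : ∏ i : Fin m, wF m v (i + 1) ^ (-(a i / 2)) =
      ∏ i : Fin m, wF m v i ^ (-(sh a i / 2)) := by
    rw [← Finset.prod_range (fun i => wF m v (i + 1) ^ (-(a i / 2))),
      ← Finset.prod_range (fun i => wF m v i ^ (-(sh a i / 2)))]
    have h3 := Finset.prod_range_succ (fun i => wF m v i ^ (-(sh a i / 2))) m
    rw [Finset.prod_range_succ'] at h3
    simpa [sh, wF] using h3
  rw [h2, ← Finset.prod_mul_distrib]
  refine Finset.prod_congr rfl fun j _ => ?_
  rw [← Real.rpow_add (hw j)]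
  have e1 : wF m v j = v j := by simp [wF]
  rw [e1]
  congr 1; ring

theorem argW_pos {m : ℕ} {y : ℕ → ℝ} (hy : ∀ i ∈ Finset.Icc 1 (m + 1), 0 < y i)
    {v : Fin m → ℝ} (hv : v ∈ posSet m) : ∀ i ∈ Finset.Icc 1 m, 0 < argW m y v i := by
  intro i hi
  rw [Finset.mem_Icc] at hi
  have := argW_eq y v ⟨i - 1, by omega⟩
  simp only [show i - 1 + 1 = i by omega, show i - 1 + 2 = i + 1 by omega] at this
  rw [this]
  exact mul_pos (hy _ (by simp; omega)) (Real.sqrt_pos.2 (div_pos (wF_pos hv _) (wF_pos hv _)))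

theorem FF_main {m : ℕ} (s : ℂ) (W : (ℕ → ℝ) → ℂ) (hW : Measurable W) (hB : HB m W) :
    ∃ C : ℝ, 0 ≤ C ∧ ∃ a : ℕ → ℝ, ∀ y : ℕ → ℝ, (∀ i ∈ Finset.Icc 1 (m + 1), 0 < y i) →
      Integrable (fun z : (Fin (m + 1) → ℝ) × (Fin m → ℝ) => FF m s y W z.1 z.2)
        ((volume.restrict (posSet (m + 1))).prod (volume.restrict (posSet m))) ∧
      ∫ v in posSet m, ∫ t in posSet (m + 1), ‖FF m s y W t v‖ ≤
        C * ∏ i : Fin (m + 1), y (i + 1) ^ a i := by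
  obtain ⟨Cw, hCw, a, ha⟩ := hB
  obtain ⟨l, hl⟩ := exists_nat_gt (|s.re| + ∑ j : Fin m, |(a j - sh a j) / 2|)
  have hsum : 0 ≤ ∑ j : Fin m, |(a j - sh a j) / 2| := Finset.sum_nonneg fun _ _ => abs_nonneg _
  have hls : |2 * s.re| < 2 * l := by
    rw [abs_mul, abs_two]; linarith
  have hlc : ∀ j : Fin m, |(a j - sh a j) / 2| < l := by
    intro j
    have := Finset.single_le_sum (f := fun j : Fin m => |(a j - sh a j) / 2|)
      (fun _ _ => abs_nonneg _) (Finset.mem_univ j)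
    have := abs_nonneg s.re
    linarith
  obtain ⟨Cg, hCg, hg⟩ := gR_int_le l (2 * s.re) hls
  set Q : (Fin m → ℝ) → ℝ := fun v => ∏ j : Fin m, (mm l (v j) * v j ^ ((a j - sh a j) / 2) / v j)
    with hQ
  have hQi : IntegrableOn Q (posSet m) := by
    unfold IntegrableOn
    rw [restrict_posSet]
    exact Integrable.fintype_prod
      (f := fun (j : Fin m) x => mm l x * x ^ ((a j - sh a j) / 2) / x)
      fun j => mm_integrable l _ (hlc j)
  have hQ0 : 0 ≤ ∫ v in posSet m, Q v := by
    refine setIntegral_nonneg (measurableSet_posSet m) fun v hv => ?_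
    refine Finset.prod_nonneg fun j _ => ?_
    have h1 := hv j
    have := mm_nonneg l h1
    positivity
  have hbd : ∀ y : ℕ → ℝ, (∀ i ∈ Finset.Icc 1 (m + 1), 0 < y i) → ∀ v ∈ posSet m,
      ∫ t in posSet (m + 1), ‖FF m s y W t v‖ ≤
        (Cg ^ (m + 1) * ((∏ i : Fin (m + 1), (Real.pi * y (i + 1)) ^ 2) ^ l)⁻¹ *
          (Cw * ∏ i : Fin m, y (i + 2) ^ a i)) * Q v := by
    intro y hy v hv
    have h1 := FF_norm_le s hy W hv l Cg hg hCg
    have h2 := ha _ (argW_pos hy hv)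
    rw [argW_prod a hy hv] at h2
    refine h1.trans ?_
    have h3 : Q v = (∏ j, mm l (v j)) * (∏ j : Fin m, v j ^ ((a j - sh a j) / 2)) *
        ∏ j, (v j)⁻¹ := by
      simp only [hQ, div_eq_mul_inv (_ * _)]
      rw [Finset.prod_mul_distrib, Finset.prod_mul_distrib]
    have h4 : 0 ≤ ∏ j, mm l (v j) := Finset.prod_nonneg fun j _ => mm_nonneg l (hv j)
    have h5 : 0 ≤ ∏ j, (v j)⁻¹ := Finset.prod_nonneg fun j _ => inv_nonneg.2 (hv j).le
    have h6 : 0 ≤ ∏ i : Fin (m + 1), (Real.pi * y (i + 1)) ^ 2 :=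
      Finset.prod_nonneg fun i _ => sq_nonneg _
    calc _ ≤ Cg ^ (m + 1) * ((∏ i : Fin (m + 1), (Real.pi * y (i + 1)) ^ 2) ^ l)⁻¹ *
        ((∏ j, mm l (v j)) * (Cw * ((∏ i : Fin m, y (i + 2) ^ a i) *
          ∏ j : Fin m, v j ^ ((a j - sh a j) / 2))) * ∏ j, (v j)⁻¹) := by gcongr
      _ = _ := by rw [h3]; ring
  refine ⟨Cg ^ (m + 1) * ((∏ _i : Fin (m + 1), Real.pi ^ 2) ^ l)⁻¹ * Cw * ∫ v in posSet m, Q v,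
    by positivity, fun i => sh a i + (-((2 * l : ℕ) : ℝ)), fun y hy => ?_⟩
  have hint : Integrable (fun z : (Fin (m + 1) → ℝ) × (Fin m → ℝ) => FF m s y W z.1 z.2)
        ((volume.restrict (posSet (m + 1))).prod (volume.restrict (posSet m))) := by
    rw [integrable_prod_iff' (measurable_FF m s y W hW).aestronglyMeasurable]
    refine ⟨?_, ?_⟩
    · filter_upwards [ae_restrict_mem (measurableSet_posSet m)] with v hv
      exact FF_integrable_t s hy W hv
    · refine Integrable.mono' (hQi.const_mul (Cg ^ (m + 1) * ((∏ i : Fin (m + 1),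
        (Real.pi * y (i + 1)) ^ 2) ^ l)⁻¹ * (Cw * ∏ i : Fin m, y (i + 2) ^ a i))) ?_ ?_
      · exact ((measurable_FF m s y W hW).norm.stronglyMeasurable.integral_prod_left'
          (μ := volume.restrict (posSet (m + 1)))).aestronglyMeasurable
      · filter_upwards [ae_restrict_mem (measurableSet_posSet m)] with v hv
        rw [Real.norm_of_nonneg (integral_nonneg fun _ => norm_nonneg _)]
        exact hbd y hy v hv
  refine ⟨hint, ?_⟩
  calc _ ≤ ∫ v in posSet m, (Cg ^ (m + 1) * ((∏ i : Fin (m + 1), (Real.pi * y (i + 1)) ^ 2) ^ l)⁻¹ *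
          (Cw * ∏ i : Fin m, y (i + 2) ^ a i)) * Q v :=
        setIntegral_mono_on (hint.norm.integral_prod_right : IntegrableOn _ (posSet m) volume)
          (Integrable.const_mul hQi (Cg ^ (m + 1) * ((∏ i : Fin (m + 1),
            (Real.pi * y (i + 1)) ^ 2) ^ l)⁻¹ * (Cw * ∏ i : Fin m, y (i + 2) ^ a i)))
          (measurableSet_posSet m) (hbd y hy)
    _ = _ := by
      rw [integral_const_mul]
      have h1 : ∏ i : Fin (m + 1), y (i + 1) ^ (sh a i + (-((2 * l : ℕ) : ℝ))) =
          (∏ i : Fin m, y (i + 2) ^ a i) * ((∏ i : Fin (m + 1), y (i + 1) ^ 2) ^ l)⁻¹ := by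
        have h2 : ∀ i : Fin (m + 1), y (i + 1) ^ (sh a i + (-((2 * l : ℕ) : ℝ))) =
            y (i + 1) ^ sh a i * ((y (i + 1) ^ 2) ^ l)⁻¹ := by
          intro i
          have := hy (i + 1) (by simp; omega)
          rw [Real.rpow_add this, Real.rpow_neg this.le, Real.rpow_natCast, pow_mul]
        simp_rw [h2]
        rw [Finset.prod_mul_distrib, Finset.prod_inv_distrib, Finset.prod_pow, Fin.prod_univ_succ]
        simp [sh]
      rw [h1]
      simp_rw [mul_pow Real.pi]
      rw [Finset.prod_mul_distrib, mul_pow, mul_inv]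
      ring

theorem measurable_KW' (m : ℕ) (ν : ℕ → ℂ) (y : ℕ → ℝ) (W : (ℕ → ℝ) → ℂ) (hW : Measurable W) :
    Measurable (fun z : (Fin (m + 1) → ℝ) × (Fin m → ℝ) => KW m ν y W z.1 z.2) := by
  have hq : Measurable (fun z : (Fin (m + 1) → ℝ) × (Fin m → ℝ) => ((y, z.1), z.2)) :=
    (measurable_const.prodMk measurable_fst).prodMk measurable_snd
  have h := (measurable_KW m ν W hW).comp hq
  simpa only [Function.comp_def] using h

theorem KW_main {m : ℕ} (hm : 1 ≤ m) (ν : ℕ → ℂ) (W : (ℕ → ℝ) → ℂ) (hW : Measurable W)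
    (hB : HB m W) :
    (∀ y : ℕ → ℝ, (∀ i ∈ Finset.Icc 1 (m + 1), 0 < y i) →
      IntegrableOn (fun z : (Fin (m + 1) → ℝ) × (Fin m → ℝ) => KW m ν y W z.1 z.2)
        (posSet (m + 1) ×ˢ posSet m) ∧
      IntegrableOn (rhsW m (ν (m + 1)) y W) (posSet m) ∧
      ∫ t in posSet (m + 1), ∫ u in posSet m, KW m ν y W t u =
        2 ^ (m + 1) * ∫ v in posSet m, rhsW m (ν (m + 1)) y W v) ∧
    HB (m + 1) (fun y => ∫ t in posSet (m + 1), ∫ u in posSet m, KW m ν y W t u) := by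
  obtain ⟨C, hC, a, h⟩ := FF_main (ν (m + 1)) W hW hB
  have hs : ∀ t ∈ posSet (m + 1), (fun j : Fin m => t j.succ) ∈ posSet m := fun t ht j => ht _
  have key : ∀ y : ℕ → ℝ, (∀ i ∈ Finset.Icc 1 (m + 1), 0 < y i) →
      ∫ t in posSet (m + 1), ∫ u in posSet m, KW m ν y W t u =
        ∫ v in posSet m, ∫ t in posSet (m + 1), FF m (ν (m + 1)) y W t v := by
    intro y hy
    rw [← integral_integral_swap (f := fun t v => FF m (ν (m + 1)) y W t v) (h y hy).1]
    refine setIntegral_congr_fun (measurableSet_posSet _) fun t ht => ?_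
    rw [cov_integral _ (hs t ht)]
    exact setIntegral_congr_fun (measurableSet_posSet _) fun v hv => kernel_eq hm ν y W ht hv
  have key2 : ∀ y : ℕ → ℝ, (∀ i ∈ Finset.Icc 1 (m + 1), 0 < y i) →
      ∫ v in posSet m, ∫ t in posSet (m + 1), FF m (ν (m + 1)) y W t v =
        2 ^ (m + 1) * ∫ v in posSet m, rhsW m (ν (m + 1)) y W v := by
    intro y hy
    rw [← integral_const_mul]
    exact setIntegral_congr_fun (measurableSet_posSet _) fun v hv => FF_int _ hy W hv
  refine ⟨fun y hy => ⟨?_, ?_, (key y hy).trans (key2 y hy)⟩, C, hC, a, fun y hy => ?_⟩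
  · have hF := (h y hy).1
    have hmeas := measurable_KW' m ν y W hW
    unfold IntegrableOn
    rw [Measure.volume_eq_prod, ← Measure.prod_restrict,
      integrable_prod_iff hmeas.aestronglyMeasurable]
    rw [integrable_prod_iff (measurable_FF m _ y W hW).aestronglyMeasurable] at hF
    refine ⟨?_, ?_⟩
    · filter_upwards [hF.1, ae_restrict_mem (measurableSet_posSet (m + 1))] with t h1 ht
      refine (cov_integrable _ (hs t ht) _).2 ?_
      refine IntegrableOn.congr_fun (h1 : IntegrableOn _ (posSet m) volume) (fun v hv => ?_)
        (measurableSet_posSet m)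
      exact (kernel_eq hm ν y W ht hv).symm
    · refine hF.2.congr ?_
      filter_upwards [ae_restrict_mem (measurableSet_posSet (m + 1))] with t ht
      symm
      rw [cov_integral _ (hs t ht)]
      refine setIntegral_congr_fun (measurableSet_posSet _) fun v hv => ?_
      rw [← kernel_eq hm ν y W ht hv, norm_smul, Real.norm_of_nonneg, smul_eq_mul]
      exact Finset.prod_nonneg fun j _ => div_nonneg (ht _).le (sq_nonneg _)
  · have h1 := (h y hy).1.integral_prod_right
    have h2 := h1.const_mul ((2 ^ (m + 1))⁻¹ : ℂ)
    refine IntegrableOn.congr_fun (h2 : IntegrableOn _ (posSet m) volume) (fun v hv => ?_)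
        (measurableSet_posSet m)
    simp only
    rw [FF_int _ hy W hv, ← mul_assoc, inv_mul_cancel₀ (pow_ne_zero _ two_ne_zero), one_mul]
  · beta_reduce
    rw [key y hy]
    refine (norm_integral_le_integral_norm _).trans (le_trans ?_ (h y hy).2)
    refine integral_mono_of_nonneg (Filter.Eventually.of_forall fun _ => norm_nonneg _)
      (h y hy).1.norm.integral_prod_right
      (Filter.Eventually.of_forall fun _ => norm_integral_le_integral_norm _)

theorem HB_one (ν : ℕ → ℂ) : HB 1 (Wt 1 ν) := by
  obtain ⟨k, hk⟩ := exists_nat_gt |2 * (ν 1).re|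
  obtain ⟨C, hC, h⟩ := gR_zz_int_le k _ hk
  refine ⟨C * (Real.pi ^ k)⁻¹, by positivity, fun _ => -(k : ℝ), fun y hy => ?_⟩
  have hy1 : 0 < y 1 := hy 1 (by simp)
  have hz : 0 < Real.pi * y 1 := mul_pos Real.pi_pos hy1
  have e : Wt 1 ν y = ∫ t in Set.Ioi 0, gC (2 * ν 1) (Real.pi * y 1) (Real.pi * y 1) t := by
    rw [gC_bessel, Wt]
    push_cast
    rw [mul_assoc]
  rw [e]
  refine (norm_integral_le_integral_norm _).trans ?_
  have e2 : ∫ t in Set.Ioi 0, ‖gC (2 * ν 1) (Real.pi * y 1) (Real.pi * y 1) t‖ =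
      ∫ t in Set.Ioi 0, gR (2 * (ν 1).re) (Real.pi * y 1) (Real.pi * y 1) t := by
    refine setIntegral_congr_fun measurableSet_Ioi fun t ht => ?_
    rw [norm_gC _ _ _ ht]
    simp
  rw [e2]
  refine (h _ hz).trans (le_of_eq ?_)
  simp [Real.rpow_neg hy1.le, mul_pow]
  ring

theorem HB_Wt (n : ℕ) (ν : ℕ → ℂ) : HB (n + 1) (Wt (n + 1) ν) := by
  induction n with
  | zero => exact HB_one ν
  | succ n ih =>
    rw [funext (Wt_succ n ν)]
    exact (KW_main (by omega) ν _ (measurable_Wt _ ν) ih).2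

/-- recursive integral representation of the class one Whittaker function,
with the conventions `u_0 = 0` and `1/u_n = 0`; both sides converge absolutely. -/
theorem stmt3 (n : ℕ) (hn : 2 ≤ n) (ν : ℕ → ℂ) (y : ℕ → ℝ)
    (hy : ∀ i ∈ Finset.Icc 1 n, 0 < y i) :
    IntegrableOn (fun z : (Fin n → ℝ) × (Fin (n - 1) → ℝ) =>
        WtKernel n ν y (fun v => Wt (n - 1) ν v) z.1 z.2)
      (posSet n ×ˢ posSet (n - 1)) ∧
    IntegrableOn (rhs3 n ν y) (posSet (n - 1)) ∧
    Wt n ν y = (2 : ℂ) ^ n * ∫ u in posSet (n - 1), rhs3 n ν y u := by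
  obtain ⟨m, rfl⟩ : ∃ m, n = m + 1 + 1 := ⟨n - 2, by omega⟩
  obtain ⟨h1, h2, h3⟩ := (KW_main (m := m + 1) (by omega) ν _ (measurable_Wt (m + 1) ν)
    (HB_Wt m ν)).1 y hy
  rw [Wt_succ, rhs3_eq]
  exact ⟨h1, h2, h3⟩

end SO
end
end

section
/- Let n ≥ 2 and let ν ∈ ℂ^n be regular. Then for every l ∈ ℕ^n, q_n(l,ν) b_l(ν) = Σ_{i=1}^{n−1} b_{l−e_i}(ν) + (1/2)(−l_{n−1}+l_n−1) b_{l−e_n}(ν). -/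
noncomputable section

open MeasureTheory Finset

namespace SO

lemma prod_change (s : Finset ℕ) (i : ℕ) (hi : i ∈ s) (f g : ℕ → ℂ) (c : ℂ)
    (h : ∀ j ∈ s, j ≠ i → f j = g j) (hc : f i = c * g i) :
    ∏ j ∈ s, f j = c * ∏ j ∈ s, g j := by
  rw [← Finset.mul_prod_erase s f hi, ← Finset.mul_prod_erase s g hi, hc, mul_assoc]
  congr 2
  apply Finset.prod_congr rfl
  intro j hj
  rw [Finset.mem_erase] at hj
  exact h j hj.2 hj.1

lemma zfact_step (z : ℤ) : (zfact (z - 1))⁻¹ = (z : ℂ) * (zfact z)⁻¹ := by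
  rcases lt_trichotomy z 0 with h | h | h
  · have h1 : ¬ (0 ≤ z) := by omega
    have h2 : ¬ (0 ≤ z - 1) := by omega
    simp only [zfact, h1, h2, if_false, inv_zero, mul_zero]
  · subst h
    simp [zfact]
  · obtain ⟨k, rfl⟩ : ∃ k : ℕ, z = (k : ℤ) + 1 := ⟨(z - 1).toNat, by omega⟩
    have h1 : (0 : ℤ) ≤ (k : ℤ) + 1 := by omega
    have h2 : (0 : ℤ) ≤ (k : ℤ) + 1 - 1 := by omega
    have h3 : ((k : ℤ) + 1).toNat = k + 1 := by omega
    have h4 : ((k : ℤ) + 1 - 1).toNat = k := by omega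
    simp only [zfact, h1, h2, if_true, h3, h4, Nat.factorial_succ]
    have h5 : ((k : ℂ) + 1) ≠ 0 := by exact_mod_cast Nat.succ_ne_zero k
    push_cast
    field_simp

lemma zfact_neg (z : ℤ) (h : z < 0) : (zfact z)⁻¹ = 0 := by
  have h1 : ¬ (0 ≤ z) := by omega
  simp only [zfact, h1, if_false, inv_zero]

lemma poch_step (a : ℂ) (ha : ∀ k : ℤ, a ≠ k) (z : ℤ) :
    (poch (a + 1) (z - 1))⁻¹ = (a + z) * (poch (a + 1) z)⁻¹ := by
  have h0 : a + z ≠ 0 := by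
    intro h
    apply ha (-z)
    push_cast
    linear_combination h
  have h1 : Complex.Gamma (a + 1 + z) = (a + z) * Complex.Gamma (a + z) := by
    rw [← Complex.Gamma_add_one _ h0]
    congr 1
    ring
  have h2 : a + 1 + ((z - 1 : ℤ) : ℂ) = a + z := by
    push_cast
    ring
  have h3 : Complex.Gamma (a + z) ≠ 0 := by
    apply Complex.Gamma_ne_zero
    intro m h
    apply ha (-z - m)
    push_cast
    linear_combination h
  have h4 : Complex.Gamma (a + 1) ≠ 0 := by
    apply Complex.Gamma_ne_zero
    intro m h
    apply ha (-1 - m)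
    push_cast
    linear_combination h
  unfold poch
  rw [h1, h2]
  field_simp

/-- The index `(k_1, …, k_M, s)`. -/
def kap (M : ℕ) (k : Fin M → ℕ) (s : ℕ) : ℕ → ℕ :=
  fun i => if i = M + 1 then s else extN M k i

/-- Inverse of the denominator. -/
def GG (M : ℕ) (ν : ℕ → ℂ) (l : ℕ → ℤ) (κ : ℕ → ℕ) : ℂ :=
  (∏ i ∈ Finset.Icc 1 (M + 1), (zfact (l i - (κ i : ℤ)))⁻¹) *
    ∏ i ∈ Finset.Icc 1 (M + 1), (poch (ν i - ν (M + 2) + 1) (l i - (κ (i - 1) : ℤ)))⁻¹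

lemma GG_congr (M : ℕ) (ν : ℕ → ℂ) (l l' : ℕ → ℤ) (κ : ℕ → ℕ)
    (h : ∀ i ∈ Finset.Icc 1 (M + 1), l i = l' i) : GG M ν l κ = GG M ν l' κ := by
  unfold GG
  congr 1 <;> exact Finset.prod_congr rfl (fun i hi => by rw [h i hi])

lemma GG_dec (M : ℕ) (ν : ℕ → ℂ) (l : ℕ → ℤ) (κ : ℕ → ℕ)
    (ha : ∀ i ∈ Finset.Icc 1 (M + 1), ∀ k : ℤ, ν i - ν (M + 2) ≠ k)
    (i : ℕ) (hi : i ∈ Finset.Icc 1 (M + 1)) :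
    GG M ν (fun j => l j - if j = i then 1 else 0) κ =
      ((l i : ℂ) - κ i) * (ν i - ν (M + 2) + l i - κ (i - 1)) * GG M ν l κ := by
  unfold GG
  rw [prod_change _ i hi _ (fun j => (zfact (l j - (κ j : ℤ)))⁻¹) ((l i : ℂ) - κ i),
    prod_change _ i hi
      (fun j => (poch (ν j - ν (M + 2) + 1)
        ((l j - if j = i then 1 else 0) - (κ (j - 1) : ℤ)))⁻¹)
      (fun j => (poch (ν j - ν (M + 2) + 1) (l j - (κ (j - 1) : ℤ)))⁻¹)
      (ν i - ν (M + 2) + l i - κ (i - 1))]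
  · ring
  · intro j _ hj
    simp [hj]
  · have := poch_step _ (ha i hi) (l i - (κ (i - 1) : ℤ))
    simp only [if_true]
    rw [show l i - 1 - (κ (i - 1) : ℤ) = l i - (κ (i - 1) : ℤ) - 1 by ring, this]
    push_cast
    ring
  · intro j _ hj
    simp [hj]
  · have := zfact_step (l i - (κ i : ℤ))
    simp only [if_true]
    rw [show l i - 1 - (κ i : ℤ) = l i - (κ i : ℤ) - 1 by ring, this]
    push_cast
    ring

lemma GG_inc (M : ℕ) (ν : ℕ → ℂ) (l : ℕ → ℤ) (κ κ' : ℕ → ℕ)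
    (ha : ∀ i ∈ Finset.Icc 1 (M + 1), ∀ k : ℤ, ν i - ν (M + 2) ≠ k)
    (i : ℕ) (hi : i ∈ Finset.Icc 1 M) (h1 : κ' i = κ i + 1) (h2 : ∀ j, j ≠ i → κ' j = κ j) :
    GG M ν l κ' =
      ((l i : ℂ) - κ i) * (ν (i + 1) - ν (M + 2) + l (i + 1) - κ i) * GG M ν l κ := by
  rw [Finset.mem_Icc] at hi
  have hi1 : i ∈ Finset.Icc 1 (M + 1) := by rw [Finset.mem_Icc]; omega
  have hi2 : i + 1 ∈ Finset.Icc 1 (M + 1) := by rw [Finset.mem_Icc]; omega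
  unfold GG
  rw [prod_change _ i hi1 _ (fun j => (zfact (l j - (κ j : ℤ)))⁻¹) ((l i : ℂ) - κ i),
    prod_change _ (i + 1) hi2
      (fun j => (poch (ν j - ν (M + 2) + 1) (l j - (κ' (j - 1) : ℤ)))⁻¹)
      (fun j => (poch (ν j - ν (M + 2) + 1) (l j - (κ (j - 1) : ℤ)))⁻¹)
      (ν (i + 1) - ν (M + 2) + l (i + 1) - κ i)]
  · ring
  · intro j hj hj'
    rw [Finset.mem_Icc] at hj
    rw [h2 (j - 1) (by omega)]
  · have := poch_step _ (ha (i + 1) hi2) (l (i + 1) - (κ i : ℤ))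
    simp only [Nat.add_sub_cancel, h1]
    rw [show l (i + 1) - ((κ i + 1 : ℕ) : ℤ) = l (i + 1) - (κ i : ℤ) - 1 by push_cast; ring, this]
    push_cast
    ring
  · intro j _ hj
    rw [h2 j hj]
  · have := zfact_step (l i - (κ i : ℤ))
    simp only [h1]
    rw [show l i - ((κ i + 1 : ℕ) : ℤ) = l i - (κ i : ℤ) - 1 by push_cast; ring, this]
    push_cast
    ring

lemma GG_last (M : ℕ) (ν : ℕ → ℂ) (l : ℕ → ℤ) (k : Fin M → ℕ) (s : ℕ) :
    GG M ν l (kap M k (s + 1)) = ((l (M + 1) : ℂ) - s) * GG M ν l (kap M k s) := by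
  have hi1 : M + 1 ∈ Finset.Icc 1 (M + 1) := by rw [Finset.mem_Icc]; omega
  unfold GG
  rw [prod_change _ (M + 1) hi1 _ (fun j => (zfact (l j - (kap M k s j : ℤ)))⁻¹)
    ((l (M + 1) : ℂ) - s), mul_assoc]
  · congr 2
    apply Finset.prod_congr rfl
    intro j hj
    rw [Finset.mem_Icc] at hj
    have : ¬ (j - 1 = M + 1) := by omega
    simp only [kap, this, if_false]
  · intro j _ hj
    simp only [kap, hj, if_false]
  · have := zfact_step (l (M + 1) - (s : ℤ))
    simp only [kap, if_true]
    rw [show l (M + 1) - ((s + 1 : ℕ) : ℤ) = l (M + 1) - (s : ℤ) - 1 by push_cast; ring, this]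
    push_cast
    ring

lemma GG_zero (M : ℕ) (ν : ℕ → ℂ) (l : ℕ → ℤ) (κ : ℕ → ℕ) (i : ℕ)
    (hi : i ∈ Finset.Icc 1 (M + 1)) (h : l i < κ i) : GG M ν l κ = 0 := by
  unfold GG
  rw [Finset.prod_eq_zero hi, zero_mul]
  exact zfact_neg _ (by omega)

lemma bB_eq (M : ℕ) (ν : ℕ → ℂ) (l : ℕ → ℤ) (s : ℕ) (hs : l (M + 2) = s) :
    bB (M + 2) ν l =
      (-1 : ℂ) ^ s * ∑' k : Fin M → ℕ, cB (M + 1) ν (kap M k s) * GG M ν l (kap M k s) := by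
  unfold bB
  change (if (∀ i ∈ Finset.Icc 1 (M + 2), 0 ≤ l i) ∧ l (M + 2) ≤ l (M + 1) then
    (-1 : ℂ) ^ (l (M + 2)) *
      ∑' k : Fin M → ℕ,
        cB (M + 1) ν (fun i => if i = M + 1 then (l (M + 2)).toNat else extN M k i) /
          ((∏ i ∈ Finset.Icc 1 M, zfact (l i - (extN M k i : ℤ))) *
            zfact (l (M + 1) - l (M + 2)) *
            ∏ i ∈ Finset.Icc 1 (M + 1),
              poch (ν i - ν (M + 2) + 1) (l i - (extN M k (i - 1) : ℤ)))
  else 0) = _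
  split_ifs with hc
  · rw [hs, zpow_natCast]
    congr 1
    apply tsum_congr
    intro k
    have e : (fun i => if i = M + 1 then ((s : ℤ)).toNat else extN M k i)
        = kap M k s := by
      funext i
      simp [kap]
    rw [e, div_eq_mul_inv]
    congr 1
    unfold GG
    rw [mul_inv, mul_inv, ← Finset.prod_inv_distrib, ← Finset.prod_inv_distrib]
    rw [Finset.prod_Icc_succ_top (by omega : 1 ≤ M + 1)
      (fun i => (zfact (l i - (kap M k s i : ℤ)))⁻¹)]
    congr 1
    · congr 1
      · apply Finset.prod_congr rfl
        intro j hj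
        rw [Finset.mem_Icc] at hj
        have : ¬ (j = M + 1) := by omega
        simp [kap, this]
      · simp [kap]
    · apply Finset.prod_congr rfl
      intro j hj
      rw [Finset.mem_Icc] at hj
      have : ¬ (j - 1 = M + 1) := by omega
      simp [kap, this]
  · symm
    convert mul_zero _
    convert tsum_zero with k
    rw [not_and_or] at hc
    have key : ∃ i ∈ Finset.Icc 1 (M + 1), l i < kap M k s i := by
      by_cases h2 : l (M + 2) ≤ l (M + 1)
      · rcases hc with hc | hc
        · push Not at hc
          obtain ⟨i, hi, hl⟩ := hc
          rw [Finset.mem_Icc] at hi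
          have : i ≠ M + 2 := by
            rintro rfl
            omega
          exact ⟨i, by rw [Finset.mem_Icc]; omega, by omega⟩
        · exact absurd h2 hc
      · refine ⟨M + 1, by rw [Finset.mem_Icc]; omega, ?_⟩
        simp only [kap, if_true]
        omega
    obtain ⟨i, hi, h⟩ := key
    rw [GG_zero M ν l _ i hi h, mul_zero]

lemma kap_mid (M : ℕ) (k : Fin M → ℕ) (s : ℕ) (j : Fin M) : kap M k s (j + 1) = k j := by
  have h1 : (j : ℕ) ≠ M := by omega
  have h2 : (j : ℕ) + 1 ≤ M := by omega
  simp [kap, extN, h1, h2]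

lemma fin_supp (M : ℕ) (ν : ℕ → ℂ) (l : ℕ → ℤ) (s : ℕ) (f : (Fin M → ℕ) → ℂ) :
    Summable (fun k : Fin M → ℕ => f k * GG M ν l (kap M k s)) := by
  apply summable_of_hasFiniteSupport
  apply Set.Finite.subset (Set.finite_Iic (fun j : Fin M => (l (j + 1)).toNat))
  intro k hk
  rw [Set.mem_Iic]
  intro j
  by_contra hj
  have hj1 : ¬ (k j ≤ (l (j + 1)).toNat) := hj
  apply hk
  simp only
  rw [GG_zero M ν l _ (j + 1) (by rw [Finset.mem_Icc]; omega), mul_zero]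
  rw [kap_mid]
  omega

lemma alg (l k ν : ℕ → ℂ) (μ : ℂ) (hk : k 0 = 0) (M : ℕ) :
    (∑ i ∈ Finset.Icc 1 (M + 1), l i ^ 2) + 1 / 2 * k (M + 1) ^ 2
      - (∑ i ∈ Finset.Icc 1 M, l i * l (i + 1)) - l (M + 1) * k (M + 1)
      + (∑ i ∈ Finset.Icc 1 M, (ν i - ν (i + 1)) * l i) + (ν (M + 1) - μ) * l (M + 1)
      + μ * k (M + 1) =
    (∑ i ∈ Finset.Icc 1 (M + 1), (l i - k i) * (ν i - μ + l i - k (i - 1)))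
      + ((∑ i ∈ Finset.Icc 1 M, k i ^ 2) + 1 / 2 * k (M + 1) ^ 2
        - (∑ i ∈ Finset.Icc 1 M, k i * k (i + 1))
        + (∑ i ∈ Finset.Icc 1 M, (ν i - ν (i + 1)) * k i) + ν (M + 1) * k (M + 1))
      - ∑ i ∈ Finset.Icc 1 M, (l i - k i) * (ν (i + 1) - μ + l (i + 1) - k i) := by
  induction M with
  | zero =>
    simp [hk]
    ring
  | succ M ih =>
    simp only [Finset.sum_Icc_succ_top (by omega : 1 ≤ M + 1 + 1),
      Finset.sum_Icc_succ_top (by omega : 1 ≤ M + 1), Nat.add_sub_cancel] at ih ⊢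
    linear_combination ih

lemma sum_dec (s : Finset ℕ) (m : ℕ → ℕ) (i d : ℕ) (hi : i ∈ s) (h : m i ≠ 0)
    (hd : ∑ j ∈ s, m j = d + 1) : ∑ j ∈ s, dec m i j = d := by
  have h1 := Finset.add_sum_erase s m hi
  have h2 := Finset.add_sum_erase s (dec m i) hi
  have h3 : ∑ j ∈ s.erase i, dec m i j = ∑ j ∈ s.erase i, m j := by
    apply Finset.sum_congr rfl
    intro j hj
    rw [Finset.mem_erase] at hj
    simp [dec, hj.1]
  have h4 : dec m i i = m i - 1 := by simp [dec]
  omega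

lemma cB_rec (M : ℕ) (ν : ℕ → ℂ) (m : ℕ → ℕ)
    (hq : 0 < ∑ i ∈ Finset.Icc 1 (M + 1), m i → qB (M + 1) m ν ≠ 0) :
    qB (M + 1) m ν * cB (M + 1) ν m =
      (∑ i ∈ Finset.Icc 1 M, if m i = 0 then 0 else cB (M + 1) ν (dec m i)) +
        (1 / 2) * (if m (M + 1) = 0 then 0 else cB (M + 1) ν (dec m (M + 1))) := by
  rcases Nat.eq_zero_or_pos (∑ i ∈ Finset.Icc 1 (M + 1), m i) with h | h
  · have hz : ∀ i ∈ Finset.Icc 1 (M + 1), m i = 0 := Finset.sum_eq_zero_iff.1 h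
    have hz' : ∀ i ∈ Finset.Icc 1 M, m i = 0 := fun i hi => hz i (by
      rw [Finset.mem_Icc] at hi ⊢
      omega)
    have hl : m (M + 1) = 0 := hz _ (by rw [Finset.mem_Icc]; omega)
    have e : ∑ i ∈ Finset.Icc 1 M, (if m i = 0 then 0 else cB (M + 1) ν (dec m i)) = 0 :=
      Finset.sum_eq_zero (fun i hi => by simp [hz' i hi])
    have hqz : qB (M + 1) m ν = 0 := by
      unfold qB
      simp only [Nat.add_sub_cancel]
      rw [Finset.sum_eq_zero (fun i hi => by simp [hz' i hi]),
        Finset.sum_eq_zero (fun i hi => by simp [hz' i hi]),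
        Finset.sum_eq_zero (fun i hi => by simp [hz' i hi]), hl]
      simp
    rw [e, hqz]
    simp [hl]
  · obtain ⟨d, hd⟩ : ∃ d, ∑ i ∈ Finset.Icc 1 (M + 1), m i = d + 1 :=
      ⟨(∑ i ∈ Finset.Icc 1 (M + 1), m i) - 1, by omega⟩
    have hd' : ∀ i ∈ Finset.Icc 1 (M + 1), m i ≠ 0 →
        cB (M + 1) ν (dec m i) = cAux (M + 1) ν d (dec m i) := by
      intro i hi h
      unfold cB
      rw [sum_dec _ m i d hi h hd]
    have hc : cB (M + 1) ν m = cAux (M + 1) ν (d + 1) m := by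
      unfold cB
      rw [hd]
    rw [hc, cAux, mul_div_cancel₀ _ (hq h)]
    simp only [Nat.add_sub_cancel]
    congr 1
    · apply Finset.sum_congr rfl
      intro i hi
      split_ifs with h0
      · rfl
      · rw [hd' i (by rw [Finset.mem_Icc] at hi ⊢; omega) h0]
    · split_ifs with h0
      · rfl
      · rw [hd' (M + 1) (by rw [Finset.mem_Icc]; omega) h0]

lemma reg_diff (M : ℕ) (ν : ℕ → ℂ) (hreg : Regular (M + 2) ν) :
    ∀ i ∈ Finset.Icc 1 (M + 1), ∀ k : ℤ, ν i - ν (M + 2) ≠ k := by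
  intro i hi k hk
  rw [Finset.mem_Icc] at hi
  let a : Fin (M + 2) := ⟨i - 1, by omega⟩
  let b : Fin (M + 2) := ⟨M + 1, by omega⟩
  have hab : a ≠ b := by
    intro h
    have := congrArg Fin.val h
    simp only [a, b] at this
    omega
  refine hreg.2 (1, fun _ => false) (Equiv.swap a b, fun _ => false) ?_ ?_
  · intro h
    have h1 := congrArg (fun w : SignedPerm (M + 2) => w.1 a) h
    simp at h1
    exact hab h1
  · intro j hj
    have hj' := Finset.mem_Icc.1 hj
    simp only [wAct, hj', and_self, dif_pos, Bool.false_eq_true, if_false, one_mul,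
      Equiv.Perm.coe_one, id]
    have hjj : j - 1 + 1 = j := by omega
    by_cases h1 : j = i
    · subst h1
      rw [show (⟨j - 1, by omega⟩ : Fin (M + 2)) = a from rfl, Equiv.swap_apply_left]
      refine ⟨k, ?_⟩
      simp only [a, b, hjj]
      exact hk
    · by_cases h2 : j = M + 2
      · subst h2
        rw [show (⟨M + 2 - 1, by omega⟩ : Fin (M + 2)) = b from rfl, Equiv.swap_apply_right]
        refine ⟨-k, ?_⟩
        have : i - 1 + 1 = i := by omega
        simp only [a, b, this]
        push_cast
        linear_combination -hk
      · refine ⟨0, ?_⟩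
        rw [Equiv.swap_apply_of_ne_of_ne]
        · simp
        · intro h
          have := congrArg Fin.val h
          simp only [a] at this
          omega
        · intro h
          have := congrArg Fin.val h
          simp only [b] at this
          omega

lemma sum_shift (N : ℕ) (f : ℕ → ℂ) (h : f 1 = 0) :
    ∑ i ∈ Finset.Icc 1 (N + 1), f i = ∑ i ∈ Finset.Icc 1 N, f (i + 1) := by
  induction N with
  | zero => simp [h]
  | succ N ih =>
    rw [Finset.sum_Icc_succ_top (by omega), ih, Finset.sum_Icc_succ_top (by omega)]

lemma reg_q (M : ℕ) (ν : ℕ → ℂ) (hreg : Regular (M + 2) ν) (m : ℕ → ℕ)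
    (hm : 0 < ∑ i ∈ Finset.Icc 1 (M + 1), m i) : qB (M + 1) m ν ≠ 0 := by
  let m' : ℕ → ℕ := fun i => if i ≤ 1 then 0 else m (i - 1)
  let w : SignedPerm (M + 2) := ((finRotate (M + 2)).symm, fun _ => false)
  have hw : ∀ i ∈ Finset.Icc 1 (M + 1), wAct (M + 2) w ν (i + 1) = ν i := by
    intro i hi
    rw [Finset.mem_Icc] at hi
    have h1 : 1 ≤ i + 1 ∧ i + 1 ≤ M + 2 := by omega
    simp only [wAct, w, h1, and_self, dif_pos, Bool.false_eq_true, if_false, one_mul,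
      Nat.add_sub_cancel]
    have : (finRotate (M + 2)).symm ⟨i, by omega⟩ = ⟨i - 1, by omega⟩ := by
      rw [Equiv.symm_apply_eq, finRotate_of_lt (by omega)]
      simp only [Fin.mk.injEq]
      omega
    rw [this]
    congr 1
    simp only
    omega
  have hm1 : m' 1 = 0 := by simp [m']
  have hm2 : ∀ i, 1 ≤ i → m' (i + 1) = m i := by
    intro i hi
    have : ¬ (i + 1 ≤ 1) := by omega
    simp only [m', this, if_false, Nat.add_sub_cancel]
  have h := hreg.1 w m' ?_
  · convert h using 1
    unfold qB
    simp only [show M + 2 - 1 = M + 1 by omega, Nat.add_sub_cancel]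
    rw [sum_shift M _ (by simp [hm1]), sum_shift M _ (by simp [hm1]),
      sum_shift M _ (by simp [hm1])]
    rw [hm2 (M + 1) (by omega), hw (M + 1) (by rw [Finset.mem_Icc]; omega)]
    congr 1
    congr 1
    · congr 1
      · congr 1
        apply Finset.sum_congr rfl
        intro i hi
        rw [Finset.mem_Icc] at hi
        rw [hm2 i (by omega)]
      · apply Finset.sum_congr rfl
        intro i hi
        rw [Finset.mem_Icc] at hi
        rw [hm2 i (by omega), hm2 (i + 1) (by omega)]
    · apply Finset.sum_congr rfl
      intro i hi
      rw [Finset.mem_Icc] at hi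
      rw [hm2 i (by omega), hw i (by rw [Finset.mem_Icc]; omega),
        hw (i + 1) (by rw [Finset.mem_Icc]; omega)]
  · obtain ⟨i, hi, hp⟩ := Finset.exists_ne_zero_of_sum_ne_zero hm.ne'
    rw [Finset.mem_Icc] at hi
    apply Finset.sum_pos' (fun _ _ => Nat.zero_le _)
    refine ⟨i + 1, by rw [Finset.mem_Icc]; omega, ?_⟩
    rw [hm2 i (by omega)]
    omega

lemma shift_sum (M : ℕ) (ν : ℕ → ℂ) (l : ℕ → ℤ) (s : ℕ) 
    (ha : ∀ i ∈ Finset.Icc 1 (M + 1), ∀ k : ℤ, ν i - ν (M + 2) ≠ k)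
    (i : ℕ) (hi : i ∈ Finset.Icc 1 M) :
    ∑' k : Fin M → ℕ, (if kap M k s i = 0 then 0 else cB (M + 1) ν (dec (kap M k s) i)) *
        GG M ν l (kap M k s) =
    ∑' k : Fin M → ℕ, cB (M + 1) ν (kap M k s) *
      (((l i : ℂ) - kap M k s i) * (ν (i + 1) - ν (M + 2) + l (i + 1) - kap M k s i)) *
        GG M ν l (kap M k s) := by
  have hi' := Finset.mem_Icc.1 hi
  let j : Fin M := ⟨i - 1, by omega⟩
  have hj : (j : ℕ) + 1 = i := by simp only [j]; omega
  let g : (Fin M → ℕ) → (Fin M → ℕ) := fun k => Function.update k j (k j + 1)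
  have hg : Function.Injective g := by
    intro k k' h
    funext t
    have ht := congrFun h t
    simp only [g] at ht
    by_cases hjt : t = j
    · subst hjt
      simpa using ht
    · simpa [hjt] using ht
  have hki : ∀ k : Fin M → ℕ, kap M k s i = k j := by
    intro k
    rw [← kap_mid M k s j, hj]
  have hg2 : ∀ k t, t ≠ i → kap M (g k) s t = kap M k s t := by
    intro k t ht
    unfold kap
    split_ifs with h1
    · rfl
    · unfold extN
      split_ifs with h2
      · simp only [g]
        rw [Function.update_of_ne]
        intro h
        have := congrArg Fin.val h
        simp only [j] at this
        omega
      · rfl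
  have hg1 : ∀ k, kap M (g k) s i = kap M k s i + 1 := by
    intro k
    rw [hki, hki]
    simp [g]
  rw [← hg.tsum_eq]
  · apply tsum_congr
    intro k
    rw [GG_inc M ν l (kap M k s) _ ha i hi (hg1 k) (hg2 k)]
    have : dec (kap M (g k) s) i = kap M k s := by
      funext t
      unfold dec
      by_cases ht : t = i
      · subst ht
        rw [Function.update_self, hg1]
        omega
      · rw [Function.update_of_ne ht, hg2 k t ht]
    rw [this, hg1, if_neg (by omega)]
    ring
  · intro k hk
    have h0 : k j ≠ 0 := by
      intro h
      apply hk
      simp only [hki, h, if_true, zero_mul]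
    refine ⟨Function.update k j (k j - 1), ?_⟩
    funext t
    by_cases ht : t = j
    · subst ht
      simp only [g, Function.update_self]
      omega
    · simp only [g, Function.update_of_ne ht]

/-- recurrence relation for the coefficients `b_l(ν)`. -/
theorem stmt5 (n : ℕ) (hn : 2 ≤ n) (ν : ℕ → ℂ) (hreg : Regular n ν) (l : ℕ → ℕ) :
    qB n l ν * bB n ν (fun i => (l i : ℤ)) =
      (∑ i ∈ Finset.Icc 1 (n - 1),
        bB n ν (fun j => (l j : ℤ) - if j = i then 1 else 0)) +
        (1 / 2) * (-(l (n - 1) : ℂ) + (l n : ℂ) - 1) *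
          bB n ν (fun j => (l j : ℤ) - if j = n then 1 else 0) := by
  obtain ⟨M, rfl⟩ : ∃ M, n = M + 2 := ⟨n - 2, by omega⟩
  have ha := reg_diff M ν hreg
  have hq := reg_q M ν hreg
  set L : ℕ → ℤ := fun i => (l i : ℤ) with hL
  set s := l (M + 2) with hs
  let C : (Fin M → ℕ) → ℂ := fun k => cB (M + 1) ν (kap M k s)
  let G : (Fin M → ℕ) → ℂ := fun k => GG M ν L (kap M k s)
  let P : ℕ → (Fin M → ℕ) → ℂ := fun i k =>
    ((l i : ℂ) - kap M k s i) * (ν i - ν (M + 2) + l i - kap M k s (i - 1))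
  let Q : ℕ → (Fin M → ℕ) → ℂ := fun i k =>
    ((l i : ℂ) - kap M k s i) * (ν (i + 1) - ν (M + 2) + l (i + 1) - kap M k s i)
  let D : ℕ → (Fin M → ℕ) → ℂ := fun i k =>
    if kap M k s i = 0 then 0 else cB (M + 1) ν (dec (kap M k s) i)
  have hsum : ∀ f : (Fin M → ℕ) → ℂ, Summable (fun k => f k * G k) :=
    fun f => fin_supp M ν L s f
  have hb : bB (M + 2) ν L = (-1 : ℂ) ^ s * ∑' k, C k * G k := bB_eq M ν L s rfl
  have hbi : ∀ i ∈ Finset.Icc 1 (M + 1), bB (M + 2) ν (fun j => (l j : ℤ) - if j = i then 1 else 0)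
      = (-1 : ℂ) ^ s * ∑' k, (C k * P i k) * G k := by
    intro i hi
    have hi' := Finset.mem_Icc.1 hi
    rw [bB_eq M ν _ s (by
      have : M + 2 ≠ i := by omega
      simp [this, hs])]
    congr 1
    apply tsum_congr
    intro k
    have := GG_dec M ν L (kap M k s) ha i hi
    simp only [hL] at this
    rw [this]
    simp only [C, P, G, hL]
    push_cast
    ring
  have hbn : (1 / 2) * (-(l (M + 1) : ℂ) + (s : ℂ) - 1) *
      bB (M + 2) ν (fun j => (l j : ℤ) - if j = M + 2 then 1 else 0)
      = (-1 : ℂ) ^ s * ∑' k, (1 / 2 * D (M + 1) k) * G k := by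
    rcases Nat.eq_zero_or_pos s with h0 | h0
    · have e1 : bB (M + 2) ν (fun j => (l j : ℤ) - if j = M + 2 then 1 else 0) = 0 := by
        unfold bB
        rw [if_neg]
        rintro ⟨h, -⟩
        have := h (M + 2) (by rw [Finset.mem_Icc]; omega)
        simp only [if_true] at this
        omega
      have e2 : ∀ k, D (M + 1) k = 0 := by
        intro k
        simp [D, kap, h0]
      simp [e1, e2]
    · obtain ⟨r, hr⟩ : ∃ r, s = r + 1 := ⟨s - 1, by omega⟩
      rw [bB_eq M ν _ r (by simp only [if_true]; omega), ← tsum_mul_left, ← tsum_mul_left,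
        ← tsum_mul_left]
      apply tsum_congr
      intro k
      have e1 : D (M + 1) k = cB (M + 1) ν (kap M k r) := by
        simp only [D]
        have : kap M k s (M + 1) = r + 1 := by simp [kap, hr]
        rw [this, if_neg (by omega)]
        congr 1
        funext t
        unfold dec
        by_cases ht : t = M + 1
        · subst ht
          rw [Function.update_self]
          simp [kap, hr]
        · rw [Function.update_of_ne ht]
          simp [kap, ht]
      have e2 : G k = ((l (M + 1) : ℂ) - r) * GG M ν L (kap M k r) := by
        simp only [G]
        rw [hr, GG_last]
        simp [hL]
      have e3 : GG M ν (fun j => (l j : ℤ) - if j = M + 2 then 1 else 0) (kap M k r) =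
          GG M ν L (kap M k r) := by
        apply GG_congr
        intro i hi
        rw [Finset.mem_Icc] at hi
        have : i ≠ M + 2 := by omega
        simp [this, hL]
      rw [e1, e2, e3, hr]
      push_cast
      ring
  have hD : ∀ i ∈ Finset.Icc 1 M, ∑' k, D i k * G k = ∑' k, (C k * Q i k) * G k := by
    intro i hi
    have := shift_sum M ν L s ha i hi
    simpa [D, C, Q, G, hL] using this
  have hpt : ∀ k, qB (M + 2) l ν * (C k * G k) =
      ((∑ i ∈ Finset.Icc 1 (M + 1), C k * P i k * G k) +
        ((∑ i ∈ Finset.Icc 1 M, D i k * G k) + 1 / 2 * D (M + 1) k * G k))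
        - ∑ i ∈ Finset.Icc 1 M, C k * Q i k * G k := by
    intro k
    have h1 := cB_rec M ν (kap M k s) (hq _)
    have h0 : kap M k s 0 = 0 := by simp [kap, extN]
    have h2 := alg (fun i => (l i : ℂ)) (fun i => (kap M k s i : ℂ)) ν (ν (M + 2))
      (by simp [h0]) M
    have h3 : kap M k s (M + 1) = s := by simp [kap]
    have h4 : qB (M + 2) l ν = (∑ i ∈ Finset.Icc 1 (M + 1), P i k) + qB (M + 1) (kap M k s) ν
        - ∑ i ∈ Finset.Icc 1 M, Q i k := by
      unfold qB
      simp only [show M + 2 - 1 = M + 1 by omega, Nat.add_sub_cancel]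
      rw [← h2]
      rw [Finset.sum_Icc_succ_top (by omega) (fun i => (l i : ℂ) * (l (i + 1) : ℂ)),
        Finset.sum_Icc_succ_top (by omega) (fun i => (ν i - ν (i + 1)) * (l i : ℂ))]
      simp only [h3, show M + 1 + 1 = M + 2 by omega, ← hs]
      ring
    simp only [← Finset.sum_mul, ← Finset.mul_sum]
    have h5 : qB (M + 1) (kap M k s) ν * C k =
      (∑ i ∈ Finset.Icc 1 M, D i k) + 1 / 2 * D (M + 1) k := h1
    rw [h4]
    linear_combination G k * h5
  have hsP : Summable (fun k => ∑ i ∈ Finset.Icc 1 (M + 1), C k * P i k * G k) :=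
    summable_sum (fun i _ => hsum (fun k => C k * P i k))
  have hsD : Summable (fun k => ∑ i ∈ Finset.Icc 1 M, D i k * G k) :=
    summable_sum (fun i _ => hsum (D i))
  have hsQ : Summable (fun k => ∑ i ∈ Finset.Icc 1 M, C k * Q i k * G k) :=
    summable_sum (fun i _ => hsum (fun k => C k * Q i k))
  have hsE : Summable (fun k => 1 / 2 * D (M + 1) k * G k) := hsum (fun k => 1 / 2 * D (M + 1) k)
  have htot : qB (M + 2) l ν * ∑' k, C k * G k =
      (∑ i ∈ Finset.Icc 1 (M + 1), ∑' k, C k * P i k * G k) +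
        ∑' k, 1 / 2 * D (M + 1) k * G k := by
    rw [← tsum_mul_left, tsum_congr hpt, (hsP.add (hsD.add hsE)).tsum_sub hsQ,
      hsP.tsum_add (hsD.add hsE), hsD.tsum_add hsE,
      Summable.tsum_finsetSum (fun i _ => hsum (fun k => C k * P i k)),
      Summable.tsum_finsetSum (fun i _ => hsum (D i)),
      Summable.tsum_finsetSum (fun i _ => hsum (fun k => C k * Q i k)),
      Finset.sum_congr rfl hD]
    ring
  simp only [show M + 2 - 1 = M + 1 by omega]
  rw [hb, hbn, Finset.sum_congr rfl hbi, ← Finset.mul_sum]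
  linear_combination (-1 : ℂ) ^ s * htot

end SO
end
end
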